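/- arXiv:1406.7784 — 4 statements merged into one kernel-verified Lean document; each statement's English description precedes it below -/
import Mathlib

section
/- The number of labeled rooted trees on vertex set {1,...,n} with root 1 in which no vertex has exactly one child equals (1/n) * \sum_{k=1}^{n} (-1)^{n-k} * C(n,k) * ((n-1)!/(k-1)!) * k^{k-1}. -/
/-- The set of children of `v` in the graph `G` rooted at `r`:
neighbors of `v` that are farther from the root. -/
def children {n : ℕ} (G : SimpleGraph (Fin n)) (r v : Fin n) : Set (Fin n) :=
  {w | G.Adj v w ∧ G.dist r w = G.dist r v + 1}

namespace LCA
open Finset MvPolynomial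

/-- rooted forests with root set R and non-root set U, as parent maps -/
noncomputable def rforests {V : Type*} [Fintype V] [DecidableEq V] (R U : Finset V) : Finset (V → V) :=
  by
    classical
    exact (Fintype.piFinset (fun v => if v ∈ U then R ∪ U else {v})).filter
      (fun f => ∀ W ⊆ U, W.Nonempty → ∃ w ∈ W, f w ∉ W)

lemma mem_rforests {V : Type*} [Fintype V] [DecidableEq V] {R U : Finset V} {f : V → V} :
    f ∈ rforests R U ↔ (∀ v ∈ U, f v ∈ R ∪ U) ∧ (∀ v ∉ U, f v = v) ∧
      ∀ W ⊆ U, W.Nonempty → ∃ w ∈ W, f w ∉ W := by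
  unfold rforests
  rw [mem_filter, Fintype.mem_piFinset, ← and_assoc]
  refine and_congr_left fun _ => ⟨fun h => ⟨fun v hv => ?_, fun v hv => ?_⟩, fun h v => ?_⟩
  · have := h v; rwa [if_pos hv] at this
  · have := h v; rw [if_neg hv] at this; simpa using this
  · split_ifs with hv
    · exact h.1 v hv
    · simpa using h.2 v hv

lemma forest_fiber {V A : Type*} [Fintype V] [DecidableEq V] [CommRing A] (x : V → A)
    (R U T : Finset V) (hRU : Disjoint R U) (hT : T ⊆ U) :
    ∑ f ∈ rforests R U with (U.filter (fun u => f u ∈ R) = T), ∏ u ∈ U, x (f u) =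
      (∑ r ∈ R, x r) ^ #T * ∑ f ∈ rforests T (U \ T), ∏ u ∈ U \ T, x (f u) := by
  have h1 : (∑ r ∈ R, x r) ^ #T =
      ∑ h ∈ Fintype.piFinset (fun v => if v ∈ T then R else {v}), ∏ u ∈ T, x (h u) := by
    have := (prod_univ_sum (fun v => if v ∈ T then R else {v})
      (fun v w => if v ∈ T then x w else 1))
    have e : ∀ h : V → V, ∏ v, (if v ∈ T then x (h v) else 1) = ∏ u ∈ T, x (h u) := by
      intro h
      rw [prod_ite_mem]; simp
    simp only [e] at this
    rw [← this, ← prod_const]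
    rw [← prod_subset (subset_univ T)]
    · exact prod_congr rfl fun v hv => by simp [hv]
    · intro v _ hv; simp [hv]
  rw [h1, sum_mul_sum, ← sum_product']
  have hd : ∀ v, v ∈ R → v ∉ U := fun v hv hu => (disjoint_left.1 hRU) hv hu
  refine sum_bij' (fun f _ => ((fun v => if v ∈ T then f v else v), (fun v => if v ∈ U \ T then f v else v)))
    (fun p _ => fun v => if v ∈ T then p.1 v else p.2 v) ?_ ?_ ?_ ?_ ?_
  · intro f hf
    simp only [mem_filter, mem_rforests] at hf
    obtain ⟨⟨h1, h2, h3⟩, h4⟩ := hf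
    have h4' : ∀ v, v ∈ T ↔ v ∈ U ∧ f v ∈ R := by intro v; rw [← h4, mem_filter]
    simp only [mem_product, Fintype.mem_piFinset, mem_rforests]
    refine ⟨fun v => ?_, ?_, ?_, ?_⟩
    · by_cases hv : v ∈ T
      · simp [hv, ((h4' v).1 hv).2]
      · simp [hv]
    · intro v hv
      have := h1 v (mem_sdiff.1 hv).1
      grind
    · intro v hv; simp only [if_neg hv]
    · intro W hW hne
      obtain ⟨w, hw, hw'⟩ := h3 W (hW.trans sdiff_subset) hne
      exact ⟨w, hw, by simpa only [if_pos (hW hw)] using hw'⟩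
  · rintro ⟨h, g⟩ hp
    simp only [mem_product, Fintype.mem_piFinset, mem_rforests] at hp
    obtain ⟨h1, h2, h3, h4⟩ := hp
    have h1' : ∀ v ∈ T, h v ∈ R := fun v hv => by have := h1 v; rwa [if_pos hv] at this
    simp only [mem_filter, mem_rforests]
    refine ⟨⟨?_, ?_, ?_⟩, ?_⟩
    · intro v hv; have := h1' v; have := h2 v; grind
    · intro v hv; have := h3 v; grind
    · intro W hW hne
      by_cases hWT : ∃ w ∈ W, w ∈ T
      · obtain ⟨w, hw, hwT⟩ := hWT
        refine ⟨w, hw, ?_⟩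
        rw [if_pos hwT]
        exact fun hh => hd _ (h1' w hwT) (hW hh)
      · push Not at hWT
        obtain ⟨w, hw, hw'⟩ := h4 W (fun w hw => mem_sdiff.2 ⟨hW hw, hWT w hw⟩) hne
        exact ⟨w, hw, by rwa [if_neg (hWT w hw)]⟩
    · ext v
      have := h1' v; have := h2 v; have := hd (g v); have := @hT v
      grind
  · intro f hf
    simp only [mem_filter, mem_rforests] at hf
    obtain ⟨⟨h1, h2, h3⟩, h4⟩ := hf
    funext v
    have := h2 v
    grind
  · rintro ⟨h, g⟩ hp
    simp only [mem_product, Fintype.mem_piFinset, mem_rforests] at hp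
    obtain ⟨h1, h2, h3, h4⟩ := hp
    refine Prod.ext ?_ ?_
    · funext v; have := h1 v; grind
    · funext v; have := h3 v; grind
  · intro f hf
    rw [← prod_sdiff hT, mul_comm]
    congr 1
    · exact prod_congr rfl fun v hv => by simp [hv]
    · exact prod_congr rfl fun v hv => by simp only [if_pos hv]

lemma forest_sum {V A : Type*} [Fintype V] [DecidableEq V] [CommRing A] [IsDomain A] (x : V → A)
    (hx : ∀ S : Finset V, S.Nonempty → ∑ v ∈ S, x v ≠ 0) (m : ℕ) :
    ∀ (R U : Finset V), Disjoint R U → #U = m →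
    (∑ v ∈ R ∪ U, x v) * ∑ f ∈ rforests R U, ∏ u ∈ U, x (f u) =
      (∑ r ∈ R, x r) * (∑ v ∈ R ∪ U, x v) ^ m := by
  induction m using Nat.strong_induction_on with
  | _ m ih =>
  intro R U hRU hm
  rcases U.eq_empty_or_nonempty with rfl | hU
  · have : rforests R (∅ : Finset V) = {fun v => v} := by
      ext f; simp only [mem_rforests, mem_singleton, funext_iff]
      constructor
      · rintro ⟨-, h, -⟩ v; exact h v (notMem_empty v)
      · intro h; refine ⟨by simp, fun v _ => h v, fun W hW hne => ?_⟩
        simp [subset_empty.1 hW] at hne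
    simp at hm
    simp [this, ← hm]
  obtain ⟨k, rfl⟩ : ∃ k, m = k + 1 := ⟨m - 1, by have := hU.card_pos; omega⟩
  rw [sum_union hRU]
  set a := ∑ r ∈ R, x r with ha
  set b := ∑ u ∈ U, x u with hb
  have hb0 : b ≠ 0 := hx U hU
  rw [← sum_fiberwise_of_maps_to (s := rforests R U) (t := U.powerset)
    (g := fun f => U.filter (fun u => f u ∈ R)) (fun f _ => mem_powerset.2 (filter_subset _ _))]
  rw [pow_succ', ← mul_assoc, mul_comm a, mul_assoc]
  congr 1
  apply mul_left_cancel₀ hb0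
  rw [sum_congr rfl (fun T hT => forest_fiber x R U T hRU (mem_powerset.1 hT)), mul_sum]
  have key : ∀ T ∈ U.powerset, b * (a ^ #T * ∑ f ∈ rforests T (U \ T), ∏ u ∈ U \ T, x (f u)) =
      ∑ u ∈ U, if u ∈ T then x u * (a ^ #T * b ^ (k + 1 - #T)) else 0 := by
    intro T hT
    rw [mem_powerset] at hT
    rw [← sum_filter, filter_mem_eq_inter, inter_eq_right.2 hT, ← sum_mul]
    rcases T.eq_empty_or_nonempty with rfl | hTne
    · have : rforests (∅ : Finset V) U = ∅ := by
        ext f; simp only [mem_rforests, notMem_empty, iff_false]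
        rintro ⟨h1, -, h3⟩
        obtain ⟨w, hw, hw'⟩ := h3 U subset_rfl hU
        exact hw' (by simpa using h1 w hw)
      simp [this]
    · have hc : #(U \ T) = k + 1 - #T := by rw [card_sdiff_of_subset hT, hm]
      have := ih (#(U \ T)) (by have := hTne.card_pos; omega) T (U \ T) disjoint_sdiff rfl
      rw [union_sdiff_of_subset hT, hc] at this
      rw [mul_left_comm, this]; ring
  rw [sum_congr rfl key, sum_comm]
  have inner : ∀ u ∈ U, (∑ T ∈ U.powerset, if u ∈ T then x u * (a ^ #T * b ^ (k + 1 - #T)) else 0) =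
      x u * (a * (a + b) ^ k) := by
    intro u hu
    have hck : #(U.erase u) = k := by rw [card_erase_of_mem hu, hm]; rfl
    conv_lhs => rw [← insert_erase hu]
    rw [sum_powerset_insert (notMem_erase u U)]
    have z : ∑ T ∈ (U.erase u).powerset, (if u ∈ T then x u * (a ^ #T * b ^ (k + 1 - #T)) else 0) = 0 := by
      refine sum_eq_zero fun T hT => if_neg fun h => ?_
      exact notMem_erase u U (mem_powerset.1 hT h)
    rw [z, zero_add, ← hck, ← sum_pow_mul_eq_add_pow, mul_sum, mul_sum]
    refine sum_congr rfl fun T hT => ?_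
    have huT : u ∉ T := fun h => notMem_erase u U (mem_powerset.1 hT h)
    rw [if_pos (mem_insert_self _ _), card_insert_of_notMem huT, Nat.add_sub_add_right]
    ring
  rw [sum_congr rfl inner, ← sum_mul]

section graphs
open SimpleGraph

/-- the graph of a parent map -/
def pgraph {V : Type*} (f : V → V) : SimpleGraph V where
  Adj v w := v ≠ w ∧ (f v = w ∨ f w = v)
  symm := ⟨fun _ _ h => ⟨h.1.symm, h.2.symm⟩⟩
  loopless := ⟨fun _ h => h.1 rfl⟩

/-- f is a parent map of G with root r -/
def IsPMap {V : Type*} (G : SimpleGraph V) (r : V) (f : V → V) : Prop :=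
  f r = r ∧ ∀ w, w ≠ r → G.Adj w (f w) ∧ G.dist r w = G.dist r (f w) + 1

lemma parent_unique {V : Type*} {G : SimpleGraph V} (hG : G.IsTree) (r v p q : V)
    (hp : G.Adj v p) (hq : G.Adj v q) (dp : G.dist r v = G.dist r p + 1)
    (dq : G.dist r v = G.dist r q + 1) : p = q := by
  classical
  have aux : ∀ p, G.Adj v p → G.dist r v = G.dist r p + 1 →
      ∃ P : G.Walk v r, P.IsPath ∧ P.snd = p := by
    intro p hp dp
    obtain ⟨P, hP⟩ := hG.connected.exists_walk_length_eq_dist p r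
    refine ⟨Walk.cons hp P, ?_, by simp⟩
    apply Walk.isPath_of_length_eq_dist
    rw [Walk.length_cons, hP, dist_comm, ← dp, dist_comm]
  obtain ⟨P, hP, rfl⟩ := aux p hp dp
  obtain ⟨Q, hQ, rfl⟩ := aux q hq dq
  rw [(hG.existsUnique_path v r).unique hP hQ]

lemma exists_pmap {V : Type*} {G : SimpleGraph V} (hG : G.IsTree) (r : V) :
    ∃ f, IsPMap G r f := by
  classical
  have : ∀ w, ∃ p, (w = r → p = r) ∧ (w ≠ r → G.Adj w p ∧ G.dist r w = G.dist r p + 1) := by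
    intro w
    by_cases hw : w = r
    · exact ⟨r, fun _ => rfl, fun h => absurd hw h⟩
    · obtain ⟨P, hP⟩ := hG.connected.exists_walk_length_eq_dist w r
      cases P with
      | nil => exact absurd rfl hw
      | @cons _ p _ h P =>
        refine ⟨p, fun h => absurd h hw, fun _ => ⟨h, ?_⟩⟩
        rw [Walk.length_cons, dist_comm] at hP
        have h1 := dist_le P
        rw [dist_comm] at h1
        rcases hG.dist_eq_dist_add_one_of_adj r h with h' | h' <;> omega
  choose f hf using this
  exact ⟨f, (hf r).1 rfl, fun w hw => (hf w).2 hw⟩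

lemma pgraph_eq {V : Type*} {G : SimpleGraph V} (hG : G.IsTree) {r : V} {f : V → V}
    (hf : IsPMap G r f) : pgraph f = G := by
  ext v w
  change (v ≠ w ∧ (f v = w ∨ f w = v)) ↔ _
  constructor
  · rintro ⟨hne, rfl | rfl⟩
    · have : v ≠ r := fun h => by subst h; exact hne hf.1.symm
      exact (hf.2 v this).1
    · have : w ≠ r := fun h => by subst h; exact hne hf.1
      exact (hf.2 w this).1.symm
  · intro h
    refine ⟨h.ne, ?_⟩
    rcases hG.dist_eq_dist_add_one_of_adj r h with h' | h'
    · left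
      have hv : v ≠ r := by rintro rfl; simp at h'
      exact parent_unique hG r v _ _ (hf.2 v hv).1 h (hf.2 v hv).2 h'
    · right
      have hw : w ≠ r := by rintro rfl; simp at h'
      exact parent_unique hG r w _ _ (hf.2 w hw).1 h.symm (hf.2 w hw).2 h'

lemma pmap_mem {V : Type*} [Fintype V] [DecidableEq V] {G : SimpleGraph V} {r : V} {f : V → V}
    (hf : IsPMap G r f) : f ∈ rforests {r} (univ.erase r) := by
  rw [mem_rforests]
  refine ⟨fun v _ => by grind, fun v hv => ?_, fun W hW hne => ?_⟩
  · have : v = r := by simpa using hv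
    subst this; exact hf.1
  · obtain ⟨w, hw, hmin⟩ := exists_min_image W (fun w => G.dist r w) hne
    refine ⟨w, hw, fun h => ?_⟩
    have h1 := hmin _ h
    have h2 := (hf.2 w (ne_of_mem_erase (hW hw))).2
    omega

lemma pgraph_tree {V : Type*} [Fintype V] [DecidableEq V] {r : V} {f : V → V}
    (hf : f ∈ rforests {r} (univ.erase r)) :
    (pgraph f).IsTree ∧ IsPMap (pgraph f) r f := by
  classical
  rw [mem_rforests] at hf
  obtain ⟨-, h2, h3⟩ := hf
  have hr : f r = r := h2 r (notMem_erase _ _)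
  have hne : ∀ w, w ≠ r → f w ≠ w := by
    intro w hw h
    obtain ⟨w', hw', h'⟩ := h3 {w} (by simp [hw]) (by simp)
    simp at hw'; subst hw'; simp [h] at h'
  have hadj : ∀ w, w ≠ r → (pgraph f).Adj w (f w) := fun w hw => ⟨(hne w hw).symm, Or.inl rfl⟩
  have hreach : ∀ w, (pgraph f).Reachable w r := by
    by_contra hcon
    push Not at hcon
    obtain ⟨w₀, hw₀⟩ := hcon
    obtain ⟨w, hw, hw'⟩ := h3 (univ.filter fun w => ¬ (pgraph f).Reachable w r)
      (fun w hw => by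
        simp only [mem_filter, mem_univ, true_and] at hw
        simp only [mem_erase, mem_univ, and_true]
        rintro rfl; exact hw (Reachable.refl _)) ⟨w₀, by simp [hw₀]⟩
    simp only [mem_filter, mem_univ, true_and, not_not] at hw hw'
    have : w ≠ r := by rintro rfl; exact hw (Reachable.refl _)
    exact hw ((hadj w this).reachable.trans hw')
  have hconn : (pgraph f).Connected :=
    { preconnected := fun u v => (hreach u).trans (hreach v).symm, nonempty := ⟨r⟩ }
  have htree : (pgraph f).IsTree := by
    rw [isTree_iff_connected_and_card]
    refine ⟨hconn, le_antisymm ?_ hconn.card_vert_le_card_edgeSet_add_one⟩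
    have hsub : (pgraph f).edgeSet ⊆ ((univ.erase r).image (fun v => s(v, f v)) : Finset (Sym2 V)) := by
      intro e
      induction e using Sym2.ind with
      | _ v w =>
        intro h
        rw [mem_edgeSet] at h
        obtain ⟨hvw, rfl | rfl⟩ := h
        · exact mem_coe.2 (mem_image.2 ⟨v, by simp; rintro rfl; exact hvw hr.symm, rfl⟩)
        · exact mem_coe.2 (mem_image.2 ⟨w, by simp; rintro rfl; exact hvw hr, Sym2.eq_swap⟩)
    have h1 := Set.ncard_le_ncard hsub (Finset.finite_toSet _)
    rw [Set.ncard_coe_finset] at h1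
    have h2 := (card_image_le (s := univ.erase r) (f := fun v => s(v, f v)))
    rw [card_erase_of_mem (mem_univ r), card_univ] at h2
    have : 0 < Fintype.card V := Fintype.card_pos_iff.2 ⟨r⟩
    rw [Nat.card_coe_set_eq, Nat.card_eq_fintype_card]
    omega
  refine ⟨htree, hr, fun w hw => ⟨hadj w hw, ?_⟩⟩
  by_contra hcon
  obtain ⟨w, hw, hw'⟩ := h3 (univ.filter fun w => w ≠ r ∧
      ¬ (pgraph f).dist r w = (pgraph f).dist r (f w) + 1)
    (fun w hw => by simp at hw; simp [hw.1]) ⟨w, by simp only [mem_filter, mem_univ, true_and]; exact ⟨hw, hcon⟩⟩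
  simp only [mem_filter, mem_univ, true_and] at hw hw'
  have hd : (pgraph f).dist r (f w) = (pgraph f).dist r w + 1 :=
    (htree.dist_eq_dist_add_one_of_adj r (hadj w hw.1)).resolve_left hw.2
  have hfr : f w ≠ r := by intro h; rw [h] at hd; simp at hd
  have hd2 : (pgraph f).dist r (f w) = (pgraph f).dist r (f (f w)) + 1 := by
    by_contra h; exact hw' ⟨hfr, h⟩
  have hff : f (f w) = w :=
    parent_unique htree r (f w) _ _ (hadj _ hfr) (hadj w hw.1).symm hd2 hd
  obtain ⟨u, hu, hu'⟩ := h3 {w, f w} (by intro z; simp; rintro (rfl | rfl); exacts [hw.1, hfr]) (by simp)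
  simp at hu hu'
  rcases hu with rfl | rfl <;> simp_all

lemma children_eq {n : ℕ} {G : SimpleGraph (Fin n)} (hG : G.IsTree) {r : Fin n}
    {f : Fin n → Fin n} (hf : IsPMap G r f) (v : Fin n) :
    (children G r v).ncard = #((univ.erase r).filter fun w => f w = v) := by
  rw [← Set.ncard_coe_finset]
  congr 1
  ext w
  simp only [children, Set.mem_ofPred_eq, coe_filter, mem_erase, mem_univ, and_true]
  constructor
  · rintro ⟨h1, h2⟩
    have hw : w ≠ r := by rintro rfl; simp at h2
    exact ⟨hw, parent_unique hG r w _ _ (hf.2 w hw).1 h1.symm (hf.2 w hw).2 h2⟩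
  · rintro ⟨hw, rfl⟩
    exact ⟨(hf.2 w hw).1.symm, (hf.2 w hw).2⟩

lemma card_trees (n : ℕ) (r : Fin n) :
    Nat.card {G : SimpleGraph (Fin n) // G.IsTree ∧ ∀ v, (children G r v).ncard ≠ 1} =
      #((rforests {r} (univ.erase r)).filter
        fun f => ∀ v, #((univ.erase r).filter fun w => f w = v) ≠ 1) := by
  rw [← Fintype.card_coe, ← Nat.card_eq_fintype_card]
  symm
  refine Nat.card_congr (Equiv.ofBijective (fun f => ⟨pgraph f.1, ?_⟩) ⟨?_, ?_⟩)
  · obtain ⟨f, hf⟩ := f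
    rw [mem_filter] at hf
    obtain ⟨h1, h2⟩ := pgraph_tree hf.1
    exact ⟨h1, fun v => by rw [children_eq h1 h2]; exact hf.2 v⟩
  · rintro ⟨f, hf⟩ ⟨g, hg⟩ h
    simp only [Subtype.mk.injEq] at h
    rw [mem_filter] at hf hg
    obtain ⟨h1, h2⟩ := pgraph_tree hf.1
    obtain ⟨h3, h4⟩ := pgraph_tree hg.1
    rw [← h] at h4
    refine Subtype.ext (funext fun w => ?_)
    by_cases hw : w = r
    · subst hw; exact h2.1.trans h4.1.symm
    · exact parent_unique h1 r w _ _ (h2.2 w hw).1 (h4.2 w hw).1 (h2.2 w hw).2 (h4.2 w hw).2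
  · rintro ⟨G, hG, hc⟩
    obtain ⟨f, hf⟩ := exists_pmap hG r
    refine ⟨⟨f, mem_filter.2 ⟨pmap_mem hf, fun v => ?_⟩⟩, Subtype.ext (pgraph_eq hG hf)⟩
    rw [← children_eq hG hf]; exact hc v

end graphs

section counting

lemma forest_gf {V : Type*} [Fintype V] [DecidableEq V] (r : V) (m : ℕ)
    (hV : Fintype.card V = m + 2) :
    ∑ f ∈ rforests {r} (univ.erase r), ∏ u ∈ univ.erase r, (X (f u) : MvPolynomial V ℚ) =
      X r * (∑ v, X v) ^ m := by
  have hx : ∀ S : Finset V, S.Nonempty → ∑ v ∈ S, (X v : MvPolynomial V ℚ) ≠ 0 := by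
    intro S hS h
    have := congrArg (MvPolynomial.eval (fun _ => (1 : ℚ))) h
    simp at this
    exact hS.ne_empty this
  have h := forest_sum (fun v => (X v : MvPolynomial V ℚ)) hx (m + 1) {r} (univ.erase r)
    (by simp) (by rw [card_erase_of_mem (mem_univ r), card_univ, hV]; rfl)
  have hu : ({r} : Finset V) ∪ univ.erase r = univ := by
    ext v; simp
  rw [hu, sum_singleton] at h
  apply mul_left_cancel₀ (hx univ ⟨r, mem_univ r⟩)
  rw [h]; ring

/-- weight functional -/
noncomputable def wfun (V : Type*) [Fintype V] : MvPolynomial V ℚ →ₗ[ℚ] ℚ := by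
  classical
  exact (basisMonomials V ℚ).constr ℚ (fun m => if ∀ v, m v ≠ 1 then (1 : ℚ) else 0)

lemma wfun_monomial (V : Type*) [Fintype V] [DecidableEq V] (m : V →₀ ℕ) :
    wfun V (monomial m 1) = if ∀ v, m v ≠ 1 then (1 : ℚ) else 0 := by
  classical
  have := (basisMonomials V ℚ).constr_basis ℚ (fun m => if ∀ v, m v ≠ 1 then (1 : ℚ) else 0) m
  rw [coe_basisMonomials] at this
  unfold wfun
  convert this

lemma count_eq {V : Type*} [Fintype V] [DecidableEq V] (r : V) (m : ℕ)
    (hV : Fintype.card V = m + 2) :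
    ((#((rforests {r} (univ.erase r)).filter
        fun f => ∀ v, #((univ.erase r).filter fun w => f w = v) ≠ 1) : ℕ) : ℚ) =
      m.factorial * PowerSeries.coeff m (∏ v : V, PowerSeries.mk
        (fun k => (if k + (if v = r then 1 else 0) ≠ 1 then (1 : ℚ) else 0) / k.factorial)) := by
  have h := congrArg (wfun V) (forest_gf r m hV)
  rw [map_sum] at h
  have hl : ∀ f : V → V, wfun V (∏ u ∈ univ.erase r, X (f u)) =
      if ∀ v, #((univ.erase r).filter fun w => f w = v) ≠ 1 then (1 : ℚ) else 0 := by
    intro f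
    have : ∏ u ∈ univ.erase r, (X (f u) : MvPolynomial V ℚ) =
        monomial (∑ u ∈ univ.erase r, Finsupp.single (f u) 1) 1 := by
      rw [monomial_sum_one]; rfl
    rw [this, wfun_monomial]
    have e : ∀ v, (∑ u ∈ univ.erase r, Finsupp.single (f u) 1) v =
        #((univ.erase r).filter fun w => f w = v) := by
      intro v
      rw [Finsupp.finsetSum_apply, card_filter]
      exact sum_congr rfl fun u _ => by rw [Finsupp.single_apply]
    simp only [e]
  rw [sum_congr rfl (fun f _ => hl f), sum_boole] at h
  rw [h, sum_pow_eq_sum_piAntidiag, mul_sum, map_sum, PowerSeries.coeff_prod, mul_sum]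
  symm
  refine sum_bij (fun l _ => (l : V → ℕ)) ?_ ?_ ?_ ?_
  · intro l hl; simpa using hl
  · intro l _ l' _ hh; exact DFunLike.coe_injective hh
  · intro g hg
    refine ⟨Finsupp.equivFunOnFinite.symm g, by simpa using hg, by simp⟩
  · intro l hl
    have hs : ∑ v, l v = m := by simpa using hl
    have hm : ((Nat.multinomial univ l : ℕ) : ℚ) = m.factorial / ∏ v, ((l v).factorial : ℚ) := by
      rw [eq_div_iff (prod_ne_zero_iff.2 fun v _ => by positivity), ← hs, mul_comm]
      exact_mod_cast Nat.multinomial_spec univ l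
    have hp : (X r : MvPolynomial V ℚ) * (((Nat.multinomial univ l : ℕ) : MvPolynomial V ℚ) *
        ∏ v, X v ^ l v) = ((Nat.multinomial univ l : ℕ) : ℚ) •
          monomial (Finsupp.single r 1 + l) (1 : ℚ) := by
      have : (∏ v, X v ^ l v : MvPolynomial V ℚ) = monomial l 1 := by
        rw [monomial_eq, Finsupp.prod_fintype] <;> simp
      rw [this, MvPolynomial.smul_eq_C_mul, map_natCast]
      rw [mul_left_comm]; congr 1
      rw [X, monomial_mul, one_mul]
    rw [hp, map_smul, wfun_monomial, hm]
    simp only [PowerSeries.coeff_mk]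
    rw [prod_div_distrib, smul_eq_mul, prod_ite_zero]
    simp only [prod_const_one, mem_univ, true_imp_iff]
    have : (∀ v, l v + (if v = r then 1 else 0) ≠ 1) ↔ (∀ v, (Finsupp.single r 1 + l : V →₀ ℕ) v ≠ 1) := by
      refine forall_congr' fun v => ?_
      rw [Finsupp.add_apply, Finsupp.single_apply, add_comm]
      simp [eq_comm]
    simp only [this]
    ring

lemma series_eq {V : Type*} [Fintype V] [DecidableEq V] (r : V) (m : ℕ)
    (hV : Fintype.card V = m + 2) :
    (∏ v : V, PowerSeries.mk
        (fun k => (if k + (if v = r then 1 else 0) ≠ 1 then (1 : ℚ) else 0) / k.factorial)) =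
      (PowerSeries.exp ℚ - 1) * (PowerSeries.exp ℚ - PowerSeries.X) ^ (m + 1) := by
  rw [← mul_prod_erase univ _ (mem_univ r)]
  congr 1
  · ext k
    rw [PowerSeries.coeff_mk, map_sub, PowerSeries.coeff_exp, PowerSeries.coeff_one]
    rcases k with _ | k <;> simp
  · rw [prod_congr rfl (g := fun _ => PowerSeries.exp ℚ - PowerSeries.X), prod_const,
      card_erase_of_mem (mem_univ r), card_univ, hV]
    · rfl
    · intro v hv
      ext k
      rw [PowerSeries.coeff_mk, map_sub, PowerSeries.coeff_exp, PowerSeries.coeff_X,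
        if_neg (ne_of_mem_erase hv)]
      rcases k with _ | _ | k <;> simp

lemma coeff_exp_pow (a k : ℕ) :
    PowerSeries.coeff k (PowerSeries.exp ℚ ^ a) = (a : ℚ) ^ k / k.factorial := by
  rw [PowerSeries.exp_pow_eq_rescale_exp, PowerSeries.coeff_rescale, PowerSeries.coeff_exp]
  simp [div_eq_mul_inv]

lemma coeff_eq (m : ℕ) :
    PowerSeries.coeff m ((PowerSeries.exp ℚ - 1) * (PowerSeries.exp ℚ - PowerSeries.X) ^ (m + 1)) =
      ∑ j ∈ range (m + 1), (-1 : ℚ) ^ j * (m + 1).choose j *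
        (((m + 2 - j : ℕ) : ℚ) ^ (m - j) - ((m + 1 - j : ℕ) : ℚ) ^ (m - j)) / (m - j).factorial := by
  have : (PowerSeries.exp ℚ - 1) * (PowerSeries.exp ℚ - PowerSeries.X) ^ (m + 1) =
    ∑ j ∈ range (m + 2), PowerSeries.C ((-1 : ℚ) ^ j * (m + 1).choose j) * (PowerSeries.X ^ j *
      (PowerSeries.exp ℚ ^ (m + 2 - j) - PowerSeries.exp ℚ ^ (m + 1 - j))) := by
    rw [sub_eq_neg_add (PowerSeries.exp ℚ) PowerSeries.X, add_pow, mul_sum]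
    refine sum_congr rfl fun j hj => ?_
    have hj' : m + 2 - j = (m + 1 - j) + 1 := by have := mem_range.1 hj; omega
    rw [hj', pow_succ, neg_pow]
    simp only [map_mul, map_pow, map_neg, map_one, map_natCast]
    ring
  rw [this, map_sum, sum_range_succ]
  have hlast : PowerSeries.coeff m (PowerSeries.C ((-1 : ℚ) ^ (m + 1) * (m + 1).choose (m + 1)) *
      (PowerSeries.X ^ (m + 1) *
      (PowerSeries.exp ℚ ^ (m + 2 - (m + 1)) - PowerSeries.exp ℚ ^ (m + 1 - (m + 1))))) = 0 := by
    rw [PowerSeries.coeff_C_mul, PowerSeries.coeff_X_pow_mul', if_neg (by omega), mul_zero]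
  rw [hlast, add_zero]
  refine sum_congr rfl fun j hj => ?_
  have hj' := mem_range.1 hj
  rw [PowerSeries.coeff_C_mul, PowerSeries.coeff_X_pow_mul', if_pos (by omega), map_sub,
    coeff_exp_pow, coeff_exp_pow]
  ring

end counting

lemma final_sum (m : ℕ) :
    (m.factorial : ℚ) * (∑ j ∈ range (m + 1), (-1 : ℚ) ^ j * (m + 1).choose j *
        (((m + 2 - j : ℕ) : ℚ) ^ (m - j) - ((m + 1 - j : ℕ) : ℚ) ^ (m - j)) / (m - j).factorial)
        * ((m + 2 : ℕ) : ℚ) =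
      ∑ i ∈ range (m + 2), (-1 : ℚ) ^ i * (m + 2).choose i *
        ((m + 1).factorial / (m + 1 - i).factorial) * ((m + 2 - i : ℕ) : ℚ) ^ (m + 1 - i) := by
  have split : ∀ j ∈ range (m + 1), (-1 : ℚ) ^ j * (m + 1).choose j *
        (((m + 2 - j : ℕ) : ℚ) ^ (m - j) - ((m + 1 - j : ℕ) : ℚ) ^ (m - j)) / (m - j).factorial =
      (-1 : ℚ) ^ j * (m + 1).choose j * ((m + 2 - j : ℕ) : ℚ) ^ (m - j) / (m - j).factorial +
      (-1 : ℚ) ^ (j + 1) * (m + 1).choose j * ((m + 1 - j : ℕ) : ℚ) ^ (m - j) / (m - j).factorial := by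
    intro j _; ring
  rw [sum_congr rfl split, sum_add_distrib, sum_range_succ' (fun j => (-1 : ℚ) ^ j * (m + 1).choose j *
    ((m + 2 - j : ℕ) : ℚ) ^ (m - j) / (m - j).factorial), sum_range_succ (fun j => (-1 : ℚ) ^ (j + 1) *
    (m + 1).choose j * ((m + 1 - j : ℕ) : ℚ) ^ (m - j) / (m - j).factorial)]
  rw [sum_range_succ (n := m + 1), sum_range_succ' (n := m)]
  have mid : ∀ j ∈ range m, (-1 : ℚ) ^ (j + 1) * (m + 2).choose (j + 1) *
        ((m + 1).factorial / (m + 1 - (j + 1)).factorial) *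
          ((m + 2 - (j + 1) : ℕ) : ℚ) ^ (m + 1 - (j + 1)) =
      (m.factorial : ℚ) * ((m + 2 : ℕ) : ℚ) *
      ((-1 : ℚ) ^ (j + 1) * (m + 1).choose (j + 1) *
        ((m + 2 - (j + 1) : ℕ) : ℚ) ^ (m - (j + 1)) / (m - (j + 1)).factorial +
      (-1 : ℚ) ^ (j + 1) * (m + 1).choose j * ((m + 1 - j : ℕ) : ℚ) ^ (m - j) / (m - j).factorial) := by
    intro j hj
    obtain ⟨d, rfl⟩ : ∃ d, m = j + 1 + d := ⟨m - (j + 1), by have := mem_range.1 hj; omega⟩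
    have e1 : j + 1 + d + 1 - (j + 1) = d + 1 := by omega
    have e2 : j + 1 + d + 2 - (j + 1) = d + 2 := by omega
    have e3 : j + 1 + d - (j + 1) = d := by omega
    have e4 : j + 1 + d + 1 - j = d + 2 := by omega
    have e5 : j + 1 + d - j = d + 1 := by omega
    rw [e1, e2, e3, e4, e5]
    have hc : ((j + 1 + d + 1).choose (j + 1) : ℚ) * (j + 1) =
        (j + 1 + d + 1).choose j * (d + 2) := by
      have := Nat.choose_succ_right_eq (j + 1 + d + 1) j
      rw [e4] at this
      exact_mod_cast this
    have hs : ((j + 1 + d + 2).choose (j + 1) : ℚ) =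
        (j + 1 + d + 1).choose j + (j + 1 + d + 1).choose (j + 1) := by
      exact_mod_cast Nat.choose_succ_succ (j + 1 + d + 1) j
    rw [hs, Nat.factorial_succ (j + 1 + d), Nat.factorial_succ d, pow_succ ((d + 2 : ℕ) : ℚ)]
    generalize ((j + 1 + d + 1).choose j : ℚ) = P at *
    generalize ((j + 1 + d + 1).choose (j + 1) : ℚ) = Q at *
    have hd : (d.factorial : ℚ) ≠ 0 := by positivity
    have hd1 : ((d : ℚ) + 1) ≠ 0 := by positivity
    push_cast
    generalize ((d : ℚ) + 2) ^ d = Y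
    generalize ((j + 1 + d).factorial : ℚ) = Z
    generalize (-1 : ℚ) ^ (j + 1) = s
    field_simp
    linear_combination (s * Z * Y) * hc
  rw [sum_congr rfl mid, ← mul_sum, sum_add_distrib]
  have e1 : m + 1 - m = 1 := by omega
  have e2 : m + 2 - (m + 1) = 1 := by omega
  have hm : (m.factorial : ℚ) ≠ 0 := by positivity
  simp only [e1, e2, Nat.sub_self, Nat.sub_zero, Nat.choose_zero_right, Nat.choose_succ_self_right,
    Nat.factorial_zero, Nat.cast_one, pow_zero]
  have hm1 : ((m + 1).factorial : ℚ) ≠ 0 := by positivity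
  rw [div_self hm1]
  have hf : ((m + 1).factorial : ℚ) = (m + 1) * m.factorial := by
    rw [Nat.factorial_succ]; push_cast; ring
  rw [hf]
  push_cast
  field_simp
  ring

lemma final_count (m : ℕ) (r : Fin (m + 2)) :
    (#((rforests {r} (univ.erase r)).filter
        fun f => ∀ v, #((univ.erase r).filter fun w => f w = v) ≠ 1) : ℤ) * ((m + 2 : ℕ) : ℤ) =
      ∑ k ∈ Icc 1 (m + 2), (-1 : ℤ) ^ (m + 2 - k) * ((m + 2).choose k) *
        (((m + 2 - 1).factorial / (k - 1).factorial : ℕ) : ℤ) * (k : ℤ) ^ (k - 1) := by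
  have h := count_eq r m (by simp)
  rw [series_eq r m (by simp), coeff_eq] at h
  have h2 := final_sum m
  rw [← h] at h2
  suffices hh : ∑ i ∈ range (m + 2), (-1 : ℚ) ^ i * (m + 2).choose i *
        ((m + 1).factorial / (m + 1 - i).factorial) * ((m + 2 - i : ℕ) : ℚ) ^ (m + 1 - i) =
      ∑ k ∈ Icc 1 (m + 2), (-1 : ℚ) ^ (m + 2 - k) * ((m + 2).choose k) *
        (((m + 2 - 1).factorial / (k - 1).factorial : ℕ) : ℚ) * (k : ℚ) ^ (k - 1) by
    rw [hh] at h2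
    have hinj : Function.Injective (fun z : ℤ => (z : ℚ)) := Int.cast_injective
    apply hinj
    simp only [Int.cast_mul, Int.cast_sum, Int.cast_pow, Int.cast_natCast, Int.cast_neg, Int.cast_one]
    convert h2
    all_goals rfl
  refine sum_nbij' (fun i => m + 2 - i) (fun k => m + 2 - k) ?_ ?_ ?_ ?_ ?_
  · intro i hi; simp at hi ⊢; omega
  · intro i hi; simp at hi ⊢; omega
  · intro i hi; simp at hi ⊢; omega
  · intro i hi; simp at hi ⊢; omega
  · intro i hi
    simp only [mem_range] at hi
    have e1 : m + 2 - (m + 2 - i) = i := by omega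
    have e2 : m + 2 - i - 1 = m + 1 - i := by omega
    rw [e1, e2, Nat.choose_symm (by omega),
      Nat.cast_div (Nat.factorial_dvd_factorial (by omega)) (by positivity)]
    rfl

end LCA

/-- The number of labeled rooted trees on `[n]` with root `1` in which no vertex has
exactly one child equals `(1/n) ∑_{k=1}^n (-1)^{n-k} C(n,k) ((n-1)!/(k-1)!) k^{k-1}`. -/
theorem stmt0 (n : ℕ) (hn : 0 < n) :
    (Nat.card {G : SimpleGraph (Fin n) // G.IsTree ∧
        ∀ v, (children G ⟨0, hn⟩ v).ncard ≠ 1} : ℤ) * n =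
      ∑ k ∈ Finset.Icc 1 n, (-1 : ℤ) ^ (n - k) * (n.choose k) *
        (((n - 1).factorial / (k - 1).factorial : ℕ) : ℤ) * (k : ℤ) ^ (k - 1) := by
  rw [LCA.card_trees n ⟨0, hn⟩]
  rcases n with _ | _ | m
  · omega
  · have h : LCA.rforests {(⟨0, hn⟩ : Fin 1)} (Finset.univ.erase ⟨0, hn⟩) = {fun v => v} := by
      ext f
      rw [LCA.mem_rforests]
      have he : (Finset.univ.erase (⟨0, hn⟩ : Fin 1)) = ∅ := by
        ext v; simp [Subsingleton.elim v ⟨0, hn⟩]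
      rw [he]
      simp only [Finset.mem_singleton]
      refine ⟨fun _ => Subsingleton.elim _ _, fun _ => ⟨by simp, fun v _ => Subsingleton.elim _ _,
        fun W hW hne => ?_⟩⟩
      simp [Finset.subset_empty.1 hW] at hne
    rw [h, Finset.filter_true_of_mem]
    · simp
    · intro f _ v
      have he : (Finset.univ.erase (⟨0, hn⟩ : Fin 1)) = ∅ := by
        ext v; simp [Subsingleton.elim v ⟨0, hn⟩]
      rw [he]
      simp
  · exact LCA.final_count m ⟨0, hn⟩
end

section
/- The number of lone-child-avoiding rooted labeled trees on vertex set {1,...,n} (with arbitrary root) equals \sum_{k=1}^{n} (-1)^{n-k} * C(n,k) * ((n-1)!/(k-1)!) * k^{k-1}. -/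
open Finset in
lemma sum_aux {α K : Type*} [DecidableEq α] [CommRing K] (x : α → K) (t y : K) (W : Finset α) :
    ∀ s : K, (t + y) * ∑ U ∈ W.powerset, t ^ U.card * ((s + ∑ u ∈ U, x u) * y ^ (W \ U).card)
      = (s * (t + y) + t * ∑ u ∈ W, x u) * (t + y) ^ W.card := by
  induction W using Finset.induction_on with
  | empty => intro s; simp; ring
  | insert a W ha ih =>
    intro s
    rw [Finset.sum_powerset_insert ha, mul_add]
    have h1 : ∑ U ∈ W.powerset, t ^ U.card * ((s + ∑ u ∈ U, x u) * y ^ (insert a W \ U).card)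
        = y * ∑ U ∈ W.powerset, t ^ U.card * ((s + ∑ u ∈ U, x u) * y ^ (W \ U).card) := by
      rw [Finset.mul_sum]
      refine Finset.sum_congr rfl fun U hU => ?_
      rw [Finset.mem_powerset] at hU
      have haU : a ∉ U := fun h => ha (hU h)
      rw [Finset.insert_sdiff_of_notMem _ haU, Finset.card_insert_of_notMem (by simp [ha])]
      ring
    have h2 : ∑ U ∈ W.powerset, t ^ (insert a U).card * ((s + ∑ u ∈ insert a U, x u) * y ^ (insert a W \ insert a U).card)
        = t * ∑ U ∈ W.powerset, t ^ U.card * (((s + x a) + ∑ u ∈ U, x u) * y ^ (W \ U).card) := by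
      rw [Finset.mul_sum]
      refine Finset.sum_congr rfl fun U hU => ?_
      rw [Finset.mem_powerset] at hU
      have haU : a ∉ U := fun h => ha (hU h)
      have : insert a W \ insert a U = W \ U := by grind
      rw [this, Finset.card_insert_of_notMem haU, Finset.sum_insert haU]
      ring
    rw [h1, h2, mul_left_comm, mul_left_comm _ t, ih s, ih (s + x a), Finset.sum_insert ha,
      Finset.card_insert_of_notMem ha]
    ring

/-- Forest with non-root vertices `W` and roots `R`, encoded as a parent function. -/
def PForest {α : Type*} [DecidableEq α] (R W : Finset α) (f : α → α) : Prop :=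
  (∀ w, w ∉ W → f w = w) ∧ (∀ w ∈ W, f w ∈ R ∪ W) ∧ ∃ d : α → ℕ, ∀ w ∈ W, d (f w) < d w

open Classical in
noncomputable def TF {α K : Type*} [Fintype α] [CommRing K] (x : α → K) (R W : Finset α) : K :=
  ∑ f : α → α with PForest R W f, ∏ w ∈ W, x (f w)

open Classical in
lemma TF_rec {α K : Type*} [Fintype α] [CommRing K] (x : α → K) (R W : Finset α)
    (hd : Disjoint R W) (r : α) (hr : r ∈ R) :
    TF x R W = ∑ U ∈ W.powerset, x r ^ U.card * TF x (R.erase r ∪ U) (W \ U) := by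
  unfold TF
  simp_rw [Finset.mul_sum]
  rw [Finset.sum_sigma']
  have hrW : r ∉ W := fun h => Finset.disjoint_left.mp hd hr h
  refine Finset.sum_bij'
    (fun f _ => ⟨W.filter (fun w => f w = r), fun w => if w ∈ W ∧ f w = r then w else f w⟩)
    (fun p _ => fun w => if w ∈ p.1 then r else p.2 w) ?_ ?_ ?_ ?_ ?_
  · intro f hf
    simp only [Finset.mem_filter, Finset.mem_univ, true_and] at hf
    obtain ⟨h1, h2, d, h3⟩ := hf
    simp only [Finset.mem_sigma, Finset.mem_powerset, Finset.filter_subset, true_and,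
      Finset.mem_filter, Finset.mem_univ]
    refine ⟨?_, ?_, d, ?_⟩
    · intro w hw; grind
    · intro w hw
      have := h2 w (by grind)
      grind
    · intro w hw
      have := h3 w (by grind)
      grind
  · rintro ⟨U, f⟩ hf
    simp only [Finset.mem_sigma, Finset.mem_powerset, Finset.mem_filter, Finset.mem_univ,
      true_and] at hf
    obtain ⟨hU, h1, h2, d, h3⟩ := hf
    simp only [Finset.mem_filter, Finset.mem_univ, true_and]
    refine ⟨?_, ?_, fun w => if w = r then 0 else d w + 1, ?_⟩
    · intro w hw; grind
    · intro w hw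
      have := h2 w
      grind
    · intro w hw
      have := h2 w
      have := h3 w
      grind
  · intro f hf
    funext w
    simp only [Finset.mem_filter]
    grind
  · rintro ⟨U, f⟩ hf
    simp only [Finset.mem_sigma, Finset.mem_powerset, Finset.mem_filter, Finset.mem_univ,
      true_and] at hf
    obtain ⟨hU, h1, h2, d, h3⟩ := hf
    have hA : W.filter (fun w => (if w ∈ U then r else f w) = r) = U := by
      ext w
      have := h2 w
      grind
    have hB : (fun w => if w ∈ W ∧ (if w ∈ U then r else f w) = r then w
        else (if w ∈ U then r else f w)) = f := by
      funext w
      have := h2 w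
      have := h1 w
      grind
    simp only [hA, hB]
  · intro f hf
    simp only
    rw [← Finset.prod_sdiff (Finset.filter_subset (fun w => f w = r) W), mul_comm]
    congr 1
    · rw [Finset.prod_congr rfl (g := fun _ => x r)]
      · simp
      · intro w hw; simp only [Finset.mem_filter] at hw; rw [hw.2]
    · refine Finset.prod_congr rfl fun w hw => ?_
      simp only [Finset.mem_sdiff, Finset.mem_filter] at hw
      rw [if_neg (by tauto)]

open Classical in
lemma TF_formula {α : Type*} [Fintype α] (N : ℕ) : ∀ (R W : Finset α), R.card + W.card = N →
    Disjoint R W →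
    (∑ u ∈ R, MvPolynomial.X u + ∑ u ∈ W, MvPolynomial.X u) *
      TF (fun u => (MvPolynomial.X u : MvPolynomial α ℚ)) R W
      = (∑ u ∈ R, MvPolynomial.X u) *
        (∑ u ∈ R, MvPolynomial.X u + ∑ u ∈ W, MvPolynomial.X u) ^ W.card := by
  induction N with
  | zero =>
    intro R W h hd
    have h1 : R = ∅ := by rw [← Finset.card_eq_zero]; omega
    have h2 : W = ∅ := by rw [← Finset.card_eq_zero]; omega
    subst h1 h2; simp
  | succ N ih =>
    intro R W h hd
    rcases W.eq_empty_or_nonempty with hW | hW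
    · subst hW
      have : (Finset.univ.filter (fun f : α → α => PForest R ∅ f)) = {id} := by
        ext f
        rw [Finset.mem_filter, Finset.mem_singleton]
        simp only [Finset.mem_univ, true_and]
        constructor
        · intro h; funext w; exact h.1 w (by simp)
        · rintro rfl; simp [PForest]
      simp [TF, this]
    rcases R.eq_empty_or_nonempty with hR | ⟨r, hr⟩
    · subst hR
      have : (Finset.univ.filter (fun f : α → α => PForest ∅ W f)) = ∅ := by
        rw [Finset.filter_eq_empty_iff]
        rintro f - ⟨h1, h2, d, h3⟩
        obtain ⟨w, hw, hm⟩ := Finset.exists_min_image W d hW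
        have h4 := h2 w hw
        simp only [Finset.empty_union] at h4
        have := h3 w hw
        have := hm _ h4
        omega
      simp [TF, this]
    · set x : α → MvPolynomial α ℚ := fun u => MvPolynomial.X u with hx
      have key : ∀ U ∈ W.powerset,
          (∑ u ∈ R.erase r, x u + ∑ u ∈ W, x u) * (x r ^ U.card * TF x (R.erase r ∪ U) (W \ U))
          = x r ^ U.card * ((∑ u ∈ R.erase r, x u + ∑ u ∈ U, x u) *
            (∑ u ∈ R.erase r, x u + ∑ u ∈ W, x u) ^ (W \ U).card) := by
        intro U hU
        rw [Finset.mem_powerset] at hU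
        have hdis : Disjoint (R.erase r) U :=
          (hd.mono_left (Finset.erase_subset _ _)).mono_right hU
        have := ih (R.erase r ∪ U) (W \ U) (by
          rw [Finset.card_union_of_disjoint hdis, Finset.card_erase_of_mem hr,
            Finset.card_sdiff_of_subset hU]
          have := Finset.card_le_card hU
          have : 0 < R.card := Finset.card_pos.mpr ⟨r, hr⟩
          omega) (by
          rw [Finset.disjoint_left] at *
          grind)
        rw [Finset.sum_union hdis, add_assoc, add_comm (∑ u ∈ U, _),
          Finset.sum_sdiff hU] at this
        rw [mul_left_comm, this]
      have hsum : ∑ u ∈ R, x u = x r + ∑ u ∈ R.erase r, x u :=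
        (Finset.add_sum_erase R x hr).symm
      have hne : ∑ u ∈ R.erase r, x u + ∑ u ∈ W, x u ≠ 0 := by
        intro h0
        have := congrArg (MvPolynomial.eval (fun _ => (1 : ℚ))) h0
        simp only [hx, map_add, map_sum, MvPolynomial.eval_X, map_zero, Finset.sum_const,
          nsmul_eq_mul, mul_one] at this
        have h5 : 0 < W.card := hW.card_pos
        norm_cast at this
        omega
      apply mul_left_cancel₀ hne
      have e := sum_aux x (x r) (∑ u ∈ R.erase r, x u + ∑ u ∈ W, x u) W (∑ u ∈ R.erase r, x u)
      rw [← Finset.sum_congr rfl key, ← Finset.mul_sum, ← TF_rec x R W hd r hr] at e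
      rw [hsum]
      linear_combination e

open Classical in
noncomputable def cnt {α : Type*} [Fintype α] (r : α) (f : α → α) : α →₀ ℕ :=
  ∑ w ∈ Finset.univ.erase r, Finsupp.single (f w) 1

open Classical in
lemma cnt_apply {α : Type*} [Fintype α] (r : α) (f : α → α) (v : α) :
    cnt r f v = ((Finset.univ.erase r).filter (fun w => f w = v)).card := by
  simp [cnt, Finsupp.finsetSum_apply, Finsupp.single_apply, Finset.sum_boole]

open Classical in
lemma prod_eq_cnt {α : Type*} [Fintype α] (r : α) (f : α → α) :
    ∏ w ∈ Finset.univ.erase r, (MvPolynomial.X (f w) : MvPolynomial α ℚ)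
      = MvPolynomial.monomial (cnt r f) 1 := by
  rw [cnt, MvPolynomial.monomial_sum_one]
  rfl

open Classical in
lemma sum_trees {α : Type*} [Fintype α] [Nonempty α] :
    ∑ r : α, ∑ f : α → α with PForest {r} (Finset.univ.erase r) f,
      (MvPolynomial.monomial (cnt r f) 1 : MvPolynomial α ℚ)
      = (∑ u : α, MvPolynomial.X u) ^ (Fintype.card α - 1) := by
  have hne : (∑ u : α, (MvPolynomial.X u : MvPolynomial α ℚ)) ≠ 0 := by
    intro h0
    have := congrArg (MvPolynomial.eval (fun _ => (1 : ℚ))) h0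
    simp at this
  apply mul_left_cancel₀ hne
  rw [Finset.mul_sum, Finset.sum_mul]
  refine Finset.sum_congr rfl fun r _ => ?_
  have := TF_formula (α := α) _ {r} (Finset.univ.erase r) rfl (by simp)
  rw [Finset.sum_singleton, Finset.add_sum_erase _ _ (Finset.mem_univ r)] at this
  rw [Finset.card_erase_of_mem (Finset.mem_univ r), Finset.card_univ] at this
  rw [← this, TF]
  simp_rw [prod_eq_cnt]

noncomputable def Lfun (α : Type*) : MvPolynomial α ℚ →ₗ[ℚ] ℚ := by
  classical
  exact (MvPolynomial.basisMonomials α ℚ).constr ℚ (fun c => if ∀ v, c v ≠ 1 then 1 else 0)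

open Classical in
lemma Lfun_monomial {α : Type*} (c : α →₀ ℕ) :
    Lfun α (MvPolynomial.monomial c 1) = if ∀ v, c v ≠ 1 then 1 else 0 := by
  have := (MvPolynomial.basisMonomials α ℚ).constr_basis ℚ
    (fun c : α →₀ ℕ => if ∀ v, c v ≠ 1 then (1 : ℚ) else 0) c
  rw [MvPolynomial.coe_basisMonomials] at this
  exact this

open Classical in
lemma Lfun_pow {α : Type*} [Fintype α] (m : ℕ) :
    Lfun α ((∑ u : α, MvPolynomial.X u) ^ m)
      = m.factorial * PowerSeries.coeff m ((PowerSeries.exp ℚ + -PowerSeries.X) ^ Fintype.card α) := by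
  rw [Finset.sum_pow_eq_sum_piAntidiag, map_sum, ← Finset.card_univ, ← Finset.prod_const,
    PowerSeries.coeff_prod, Finset.mul_sum]
  refine Finset.sum_bij' (fun c _ => Finsupp.equivFunOnFinite.symm c) (fun c _ => ⇑c) ?_ ?_ ?_ ?_ ?_
  · intro c hc
    rw [Finset.mem_piAntidiag] at hc
    rw [Finset.mem_finsuppAntidiag]
    exact ⟨by simpa using hc.1, by simp⟩
  · intro c hc
    rw [Finset.mem_piAntidiag]
    rw [Finset.mem_finsuppAntidiag] at hc
    exact ⟨by simpa using hc.1, by simp⟩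
  · intro c hc; rfl
  · intro c hc; ext; rfl
  · intro c hc
    rw [Finset.mem_piAntidiag] at hc
    have h1 : ∏ i, (MvPolynomial.X i : MvPolynomial α ℚ) ^ c i
        = MvPolynomial.monomial (Finsupp.equivFunOnFinite.symm c) 1 := by
      rw [MvPolynomial.monomial_eq, Finsupp.prod_fintype _ _ (by simp)]
      simp
    have h2 : ∀ k : ℕ, PowerSeries.coeff k (PowerSeries.exp ℚ + -PowerSeries.X)
        = (if k ≠ 1 then 1 else 0) * ((k.factorial : ℚ))⁻¹ := by
      intro k
      rw [map_add, map_neg, PowerSeries.coeff_exp, PowerSeries.coeff_X]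
      by_cases hk : k = 1
      · subst hk; simp
      · simp [hk]
    rw [h1, ← nsmul_eq_mul, map_nsmul, Lfun_monomial, nsmul_eq_mul]
    simp_rw [h2]
    rw [Finset.prod_mul_distrib, Finset.prod_boole, Finset.prod_inv_distrib]
    have h3 := Nat.multinomial_spec Finset.univ c
    rw [hc.1] at h3
    rw [← h3]
    have h4 : (∏ i, ((c i).factorial : ℚ)) ≠ 0 :=
      Finset.prod_ne_zero_iff.mpr fun i _ => by exact_mod_cast (c i).factorial_ne_zero
    push_cast
    simp only [Finsupp.equivFunOnFinite_symm_apply_apply, Finset.mem_univ, true_implies]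
    field_simp

lemma coeff_calc (n : ℕ) (hn : 1 ≤ n) :
    (((n - 1).factorial : ℚ)) * PowerSeries.coeff (n - 1)
      ((PowerSeries.exp ℚ + -PowerSeries.X) ^ n)
    = ∑ k ∈ Finset.Icc 1 n, (-1 : ℚ) ^ (n - k) * (n.choose k) *
        (((n - 1).factorial / (k - 1).factorial : ℕ) : ℚ) * (k : ℚ) ^ (k - 1) := by
  have h0 : ∀ k ≤ n, PowerSeries.coeff (n - 1)
      (PowerSeries.exp ℚ ^ k * (-PowerSeries.X) ^ (n - k) * (n.choose k : PowerSeries ℚ))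
      = if k = 0 then 0 else (-1 : ℚ) ^ (n - k) * (n.choose k) *
        ((k : ℚ) ^ (k - 1) * ((k - 1).factorial : ℚ)⁻¹) := by
    intro k hk
    have : PowerSeries.exp ℚ ^ k * (-PowerSeries.X) ^ (n - k) * (n.choose k : PowerSeries ℚ)
        = PowerSeries.C ((-1 : ℚ) ^ (n - k) * (n.choose k)) *
          (PowerSeries.X ^ (n - k) * PowerSeries.exp ℚ ^ k) := by
      rw [neg_pow]; simp; ring
    rw [this, PowerSeries.coeff_C_mul, PowerSeries.coeff_X_pow_mul']
    split_ifs with h1 h2 h2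
    · omega
    · rw [PowerSeries.exp_pow_eq_rescale_exp, PowerSeries.coeff_rescale, PowerSeries.coeff_exp]
      have : n - 1 - (n - k) = k - 1 := by omega
      rw [this]; simp
    · simp
    · omega
  rw [add_pow, map_sum, Finset.mul_sum]
  symm
  apply Finset.sum_subset_zero_on_sdiff
  · intro k hk; simp at *; omega
  · intro k hk
    simp only [Finset.mem_sdiff, Finset.mem_range, Finset.mem_Icc] at hk
    rw [h0 k (by omega), if_pos (by omega), mul_zero]
  · intro k hk
    rw [Finset.mem_Icc] at hk
    rw [h0 k hk.2, if_neg (by omega), Nat.cast_div (Nat.factorial_dvd_factorial (by omega))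
      (by exact_mod_cast Nat.factorial_ne_zero _)]
    field_simp

/-- Rooted trees as parent functions. -/
def PTree {α : Type*} (r : α) (f : α → α) : Prop :=
  f r = r ∧ ∃ d : α → ℕ, ∀ w, w ≠ r → d (f w) < d w

open Classical in
lemma pforest_iff {α : Type*} [Fintype α] (r : α) (f : α → α) :
    PForest {r} (Finset.univ.erase r) f ↔ PTree r f := by
  unfold PForest PTree
  constructor
  · rintro ⟨h1, -, d, h3⟩
    exact ⟨h1 r (by simp), d, fun w hw => h3 w (by simp [hw])⟩
  · rintro ⟨h1, d, h3⟩
    refine ⟨?_, ?_, d, fun w hw => h3 w (by simpa using hw)⟩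
    · intro w hw
      simp at hw; subst hw; exact h1
    · intro w _; simp

open Classical in
lemma count_ptrees (n : ℕ) (hn : 1 ≤ n) :
    (Nat.card {p : Fin n × (Fin n → Fin n) // PTree p.1 p.2 ∧
        ∀ v, {w | w ≠ p.1 ∧ p.2 w = v}.ncard ≠ 1} : ℤ) =
      ∑ k ∈ Finset.Icc 1 n, (-1 : ℤ) ^ (n - k) * (n.choose k) *
        (((n - 1).factorial / (k - 1).factorial : ℕ) : ℤ) * (k : ℤ) ^ (k - 1) := by
  have : Nonempty (Fin n) := ⟨⟨0, hn⟩⟩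
  have h := congrArg (Lfun (Fin n)) (sum_trees (α := Fin n))
  rw [Lfun_pow, Fintype.card_fin, coeff_calc n hn, map_sum] at h
  simp_rw [map_sum, Lfun_monomial] at h
  have h2 : ∀ (r : Fin n) (f : Fin n → Fin n) (v : Fin n),
      cnt r f v = {w | w ≠ r ∧ f w = v}.ncard := by
    intro r f v
    rw [cnt_apply, ← Set.ncard_coe_finset]
    congr 1
    ext w; simp
  simp_rw [h2, pforest_iff] at h
  apply Int.cast_injective (α := ℚ)
  rw [Int.cast_sum]
  simp only [Int.cast_mul, Int.cast_pow, Int.cast_neg, Int.cast_one, Int.cast_natCast]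
  rw [← h]
  rw [Nat.card_eq_fintype_card, Fintype.card_subtype, Finset.card_filter, Fintype.sum_prod_type]
  push_cast
  refine Finset.sum_congr rfl fun r _ => ?_
  rw [Finset.sum_filter]
  refine Finset.sum_congr (by ext; simp only [Finset.mem_univ]) fun f _ => ?_
  simp only [ite_and]

lemma ptree_graph_adj {α : Type*} (f : α → α) (a b : α) :
    (SimpleGraph.fromRel (fun a b => f a = b)).Adj a b ↔ a ≠ b ∧ (f a = b ∨ f b = a) := by
  simp [SimpleGraph.fromRel_adj]

lemma ptree_ne {α : Type*} {r : α} {f : α → α} (h : PTree r f) {w : α} (hw : w ≠ r) :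
    f w ≠ w := by
  obtain ⟨_, d, hd⟩ := h
  intro e
  have := hd w hw
  rw [e] at this; omega

lemma ptree_connected {α : Type*} {r : α} {f : α → α} (h : PTree r f) :
    (SimpleGraph.fromRel (fun a b => f a = b)).Connected := by
  obtain ⟨h0, d, hd⟩ := id h
  have key : ∀ N w, d w = N → (SimpleGraph.fromRel (fun a b => f a = b)).Reachable w r := by
    intro N
    induction N using Nat.strong_induction_on with
    | _ N ih =>
      intro w hw
      by_cases hwr : w = r
      · subst hwr; exact SimpleGraph.Reachable.refl _
      · have h1 := ih _ (hw ▸ hd w hwr) (f w) rfl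
        refine SimpleGraph.Reachable.trans (SimpleGraph.Adj.reachable ?_) h1
        rw [ptree_graph_adj]
        exact ⟨(ptree_ne h hwr).symm, Or.inl rfl⟩
  have : Nonempty α := ⟨r⟩
  exact ⟨fun a b => (key _ a rfl).trans (key _ b rfl).symm⟩

open Classical in
lemma ptree_isTree {α : Type*} [Fintype α] {r : α} {f : α → α} (h : PTree r f) :
    (SimpleGraph.fromRel (fun a b => f a = b)).IsTree := by
  rw [SimpleGraph.isTree_iff_connected_and_card]
  have hc := ptree_connected h
  refine ⟨hc, le_antisymm ?_ hc.card_vert_le_card_edgeSet_add_one⟩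
  have hsurj : (SimpleGraph.fromRel (fun a b => f a = b)).edgeSet
      ⊆ ((Finset.univ.erase r).image (fun w => s(w, f w)) : Finset (Sym2 α)) := by
    intro e
    induction e using Sym2.ind with
    | _ a b =>
      rw [SimpleGraph.mem_edgeSet, ptree_graph_adj]
      rintro ⟨hab, rfl | rfl⟩
      · simp only [Finset.coe_image, Set.mem_image]
        refine ⟨a, ?_, rfl⟩
        simp only [Finset.coe_erase, Finset.coe_univ, Set.mem_sdiff, Set.mem_univ, true_and,
          Set.mem_singleton_iff]
        rintro rfl; exact hab h.1.symm
      · simp only [Finset.coe_image, Set.mem_image]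
        refine ⟨b, ?_, Sym2.eq_swap⟩
        simp only [Finset.coe_erase, Finset.coe_univ, Set.mem_sdiff, Set.mem_univ, true_and,
          Set.mem_singleton_iff]
        rintro rfl; exact hab h.1
  have h1 := Set.ncard_le_ncard hsurj (Finset.finite_toSet _)
  rw [Set.ncard_coe_finset] at h1
  have h2 := h1.trans Finset.card_image_le
  rw [Finset.card_erase_of_mem (Finset.mem_univ r), Finset.card_univ] at h2
  have h3 : 0 < Fintype.card α := Fintype.card_pos_iff.mpr ⟨r⟩
  rw [Nat.card_coe_set_eq, Nat.card_eq_fintype_card]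
  omega

lemma exists_pred {α : Type*} {G : SimpleGraph α} (hG : G.Connected) (r w : α) (hw : w ≠ r) :
    ∃ u, G.Adj w u ∧ G.dist r w = G.dist r u + 1 := by
  obtain ⟨p, hp⟩ := hG.exists_walk_length_eq_dist w r
  cases p with
  | nil => exact absurd rfl hw
  | @cons _ u _ hadj q =>
    refine ⟨u, hadj, ?_⟩
    rw [SimpleGraph.Walk.length_cons] at hp
    have h1 := SimpleGraph.dist_le q
    have h2 := hG.dist_triangle (u := w) (v := u) (w := r)
    rw [SimpleGraph.dist_eq_one_iff_adj.mpr hadj] at h2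
    rw [SimpleGraph.dist_comm (u := r), SimpleGraph.dist_comm (u := r)]
    omega

lemma ptree_dist {α : Type*} {r : α} {f : α → α} (h : PTree r f) (w : α) (hw : w ≠ r) :
    (SimpleGraph.fromRel (fun a b => f a = b)).dist r w
      = (SimpleGraph.fromRel (fun a b => f a = b)).dist r (f w) + 1 := by
  have hc := ptree_connected h
  set G := SimpleGraph.fromRel (fun a b => f a = b) with hG
  have key : ∀ N w, w ≠ r → G.dist r w = N → G.dist r w = G.dist r (f w) + 1 := by
    intro N
    induction N using Nat.strong_induction_on with
    | _ N ih =>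
      intro w hw hN
      obtain ⟨u, hu1, hu2⟩ := exists_pred hc r w hw
      rw [hG, ptree_graph_adj] at hu1
      rcases hu1.2 with e | e
      · rw [e]; exact hu2
      · have hur : u ≠ r := by
          rintro rfl
          exact hu1.1 (e.symm.trans h.1)
        have := ih _ (by omega) u hur rfl
        rw [e] at this
        omega
  exact key _ w hw rfl

lemma ptree_children {n : ℕ} {r : Fin n} {f : Fin n → Fin n} (h : PTree r f) (v : Fin n) :
    children (SimpleGraph.fromRel (fun a b => f a = b)) r v = {w | w ≠ r ∧ f w = v} := by
  ext w
  simp only [children, Set.mem_ofPred_eq]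
  rw [ptree_graph_adj]
  constructor
  · rintro ⟨⟨h1, h2⟩, h3⟩
    have hw : w ≠ r := by
      rintro rfl
      rw [SimpleGraph.dist_self] at h3; omega
    refine ⟨hw, ?_⟩
    rcases h2 with e | e
    · by_cases hv : v = r
      · subst hv; exact absurd (h.1.symm.trans e) h1
      · have := ptree_dist h v hv
        rw [e] at this; omega
    · exact e
  · rintro ⟨h1, rfl⟩
    exact ⟨⟨ptree_ne h h1, Or.inr rfl⟩, ptree_dist h w h1⟩

lemma ptree_inj {α : Type*} {r : α} {f g : α → α} (hf : PTree r f) (hg : PTree r g)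
    (e : SimpleGraph.fromRel (fun a b => f a = b) = SimpleGraph.fromRel (fun a b => g a = b)) :
    f = g := by
  funext w
  by_cases hw : w = r
  · subst hw; rw [hf.1, hg.1]
  have h1 := ptree_dist hf w hw
  have h2 : (SimpleGraph.fromRel (fun a b => f a = b)).Adj w (f w) := by
    rw [ptree_graph_adj]; exact ⟨(ptree_ne hf hw).symm, Or.inl rfl⟩
  rw [e] at h1 h2
  rw [ptree_graph_adj] at h2
  rcases h2.2 with h3 | h3
  · exact h3.symm
  · have h4 : f w ≠ r := by
      intro h5
      rw [h5, hg.1] at h3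
      exact hw h3.symm
    have := ptree_dist hg (f w) h4
    rw [h3] at this
    omega

open Classical in
lemma ptree_surj {α : Type*} [Fintype α] (r : α) (G : SimpleGraph α) (hG : G.IsTree) :
    ∃ f, PTree r f ∧ SimpleGraph.fromRel (fun a b => f a = b) = G := by
  have hex : ∀ w, ∃ u, (w = r → u = r) ∧ (w ≠ r → G.Adj w u ∧ G.dist r w = G.dist r u + 1) := by
    intro w
    by_cases hw : w = r
    · exact ⟨r, by simp [hw]⟩
    · obtain ⟨u, hu⟩ := exists_pred hG.connected r w hw
      exact ⟨u, by simp [hw], fun _ => hu⟩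
  choose f hf1 hf2 using hex
  have hp : PTree r f := ⟨hf1 r rfl, G.dist r, fun w hw => by have := (hf2 w hw).2; omega⟩
  refine ⟨f, hp, ?_⟩
  have hle : SimpleGraph.fromRel (fun a b => f a = b) ≤ G := by
    intro a b hab
    rw [ptree_graph_adj] at hab
    obtain ⟨hne, rfl | rfl⟩ := hab
    · exact (hf2 a (by rintro rfl; exact hne hp.1.symm)).1
    · exact (hf2 b (by rintro rfl; exact hne hp.1)).1.symm
  have h1 := (SimpleGraph.isTree_iff_connected_and_card.mp hG).2
  have h2 := (SimpleGraph.isTree_iff_connected_and_card.mp (ptree_isTree hp)).2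
  rw [Nat.card_coe_set_eq] at h1 h2
  apply SimpleGraph.edgeSet_injective
  exact Set.eq_of_subset_of_ncard_le (SimpleGraph.edgeSet_mono hle) (by omega) (Set.toFinite _)

lemma count_eq (n : ℕ) :
    Nat.card {p : Fin n × SimpleGraph (Fin n) // p.2.IsTree ∧
        ∀ v, (children p.2 p.1 v).ncard ≠ 1}
    = Nat.card {p : Fin n × (Fin n → Fin n) // PTree p.1 p.2 ∧
        ∀ v, {w | w ≠ p.1 ∧ p.2 w = v}.ncard ≠ 1} := by
  symm
  refine Nat.card_eq_of_bijective
    (fun p => ⟨(p.1.1, SimpleGraph.fromRel (fun a b => p.1.2 a = b)), ptree_isTree p.2.1, ?_⟩) ⟨?_, ?_⟩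
  · intro v
    have := p.2.2 v
    rwa [← ptree_children p.2.1 v] at this
  · rintro ⟨⟨r, f⟩, hf, hf'⟩ ⟨⟨s, g⟩, hg, hg'⟩ e
    simp only [Subtype.mk.injEq, Prod.mk.injEq] at e
    obtain ⟨rfl, e⟩ := e
    have := ptree_inj hf hg e
    subst this; rfl
  · rintro ⟨⟨r, G⟩, hG, hG'⟩
    obtain ⟨f, hf, rfl⟩ := ptree_surj r G hG
    refine ⟨⟨⟨r, f⟩, hf, ?_⟩, rfl⟩
    intro v
    have := hG' v
    rwa [ptree_children hf v] at this

/-- The number of lone-child-avoiding rooted labeled trees on `[n]` (with arbitrary root)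
equals `∑_{k=1}^n (-1)^{n-k} C(n,k) ((n-1)!/(k-1)!) k^{k-1}`. -/
theorem stmt1 (n : ℕ) :
    (Nat.card {p : Fin n × SimpleGraph (Fin n) // p.2.IsTree ∧
        ∀ v, (children p.2 p.1 v).ncard ≠ 1} : ℤ) =
      ∑ k ∈ Finset.Icc 1 n, (-1 : ℤ) ^ (n - k) * (n.choose k) *
        (((n - 1).factorial / (k - 1).factorial : ℕ) : ℤ) * (k : ℤ) ^ (k - 1) := by
  rcases Nat.eq_zero_or_pos n with hn | hn
  · subst hn
    simp
  · rw [count_eq]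
    exact count_ptrees n hn
end

section
/- For n ≥ 1 and 1 ≤ k ≤ n, the number of G-configurations of size n (with root 1) having exactly k tree vertices equals (1/n) * C(n,k) * k^{k-1} * (n-1)!/(k-1)!. -/
/-- A rooted `G`-configuration of size `n`: a nonempty subset `V ⊆ [n]`, an undirected
tree on `V` with a designated root `r ∈ V` (represented as a graph on `Fin n` whose edges
lie inside `V`, acyclic and connected on `V`), and for each vertex outside `V` exactly one
arc to a vertex `≠ r`, no two arcs ending at the same vertex.  (The arc map is recorded as
a total function that is the identity on `V`.) -/
structure GConfig (n : ℕ) where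
  V : Finset (Fin n)
  root : Fin n
  hroot : root ∈ V
  tree : SimpleGraph (Fin n)
  hedge : ∀ v w, tree.Adj v w → v ∈ V ∧ w ∈ V
  hconn : ∀ v ∈ V, ∀ w ∈ V, tree.Reachable v w
  hacyc : tree.IsAcyclic
  arc : Fin n → Fin n
  harcV : ∀ v ∈ V, arc v = v
  harc : ∀ v, v ∉ V → arc v ≠ root
  hinj : ∀ v w, v ∉ V → w ∉ V → arc v = arc w → v = w

namespace GC

/-- `m` is eventually mapped to the left (root) summand. -/
inductive Reach {R M : Type} (f : M → R ⊕ M) : M → Prop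
  | base (m : M) (r : R) (h : f m = Sum.inl r) : Reach f m
  | step (m m' : M) (h : f m = Sum.inr m') (h' : Reach f m') : Reach f m

/-- Rooted forests on `R ⊕ M` with root set `R`. -/
abbrev Forest (R M : Type) := {f : M → R ⊕ M // ∀ m, Reach f m}

/-- Underlying element. -/
def down {M : Type} {S : Finset M} : {m // m ∈ S} ⊕ {m // m ∉ S} → M :=
  Sum.elim Subtype.val Subtype.val

theorem down_inj {M : Type} {S : Finset M} :
    Function.Injective (down : {m // m ∈ S} ⊕ {m // m ∉ S} → M) := by
  rintro (⟨a, ha⟩ | ⟨a, ha⟩) (⟨b, hb⟩ | ⟨b, hb⟩) h <;> simp [down] at h ⊢ <;> grind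

theorem down_surj {M : Type} (S : Finset M) (m : M) :
    ∃ x : {m // m ∈ S} ⊕ {m // m ∉ S}, down x = m := by
  by_cases h : m ∈ S
  · exact ⟨Sum.inl ⟨m, h⟩, rfl⟩
  · exact ⟨Sum.inr ⟨m, h⟩, rfl⟩

open Classical in
/-- Glue the first level and the remaining forest. -/
noncomputable def glue {R M : Type} (S : Finset M) (a : {m // m ∈ S} → R)
    (g : {m // m ∉ S} → {m // m ∈ S} ⊕ {m // m ∉ S}) : M → R ⊕ M :=
  fun m => if h : m ∈ S then Sum.inl (a ⟨m, h⟩) else Sum.inr (down (g ⟨m, h⟩))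

theorem glue_reach {R M : Type} (S : Finset M) (a : {m // m ∈ S} → R)
    (g : {m // m ∉ S} → {m // m ∈ S} ⊕ {m // m ∉ S}) (m : {m // m ∉ S}) :
    Reach g m ↔ Reach (glue S a g) m.1 := by
  constructor
  · intro h
    induction h with
    | base m r h =>
      refine Reach.step _ r.1 ?_ (Reach.base _ (a r) ?_)
      · simp [glue, m.2, h, down]
      · simp [glue, r.2]
    | step m m' h h' ih =>
      refine Reach.step _ m'.1 ?_ ih
      simp [glue, m.2, h, down]
  · obtain ⟨m, hm⟩ := m
    intro h
    simp only at h
    induction h with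
    | base m r h => simp [glue, hm] at h
    | step m m' h h' ih =>
      simp only [glue, hm, dite_false, Sum.inr.injEq] at h
      rcases hg : g ⟨m, hm⟩ with s | s
      · exact Reach.base _ s hg
      · rw [hg] at h
        simp only [down, Sum.elim_inr] at h
        subst h
        exact Reach.step _ s hg (ih s.2)

theorem glue_mem {R M : Type} (S : Finset M) (a : {m // m ∈ S} → R)
    (g : {m // m ∉ S} → {m // m ∈ S} ⊕ {m // m ∉ S}) (m : M) :
    m ∈ S ↔ (glue S a g m).isLeft := by
  by_cases h : m ∈ S <;> simp [glue, h]

theorem card_fiber {R M : Type} [Finite R] [Finite M] (S : Finset M) :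
    Nat.card {f : Forest R M // ∀ m, m ∈ S ↔ (f.1 m).isLeft} =
      Nat.card R ^ S.card * Nat.card (Forest {m // m ∈ S} {m // m ∉ S}) := by
  have h1 : Nat.card R ^ S.card = Nat.card ({m // m ∈ S} → R) := by
    rw [Nat.card_fun]; simp
  rw [h1, ← Nat.card_prod]
  symm
  have hr : ∀ x : ({m // m ∈ S} → R) × Forest {m // m ∈ S} {m // m ∉ S},
      ∀ m, Reach (glue S x.1 x.2.1) m := by
    intro x m
    by_cases h : m ∈ S
    · exact Reach.base _ (x.1 ⟨m, h⟩) (by simp [glue, h])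
    · exact (glue_reach S x.1 x.2.1 ⟨m, h⟩).1 (x.2.2 _)
  refine Nat.card_eq_of_bijective
    (fun x => ⟨⟨glue S x.1 x.2.1, hr x⟩, glue_mem S x.1 x.2.1⟩) ⟨?_, ?_⟩
  · rintro ⟨a, g, hg⟩ ⟨a', g', hg'⟩ h
    simp only [Subtype.mk.injEq] at h
    have h1 : a = a' := by
      funext m
      have := congrFun h m.1
      simpa [glue, m.2] using this
    have h2 : g = g' := by
      funext m
      have := congrFun h m.1
      simp only [glue, m.2, dite_false, Sum.inr.injEq] at this
      exact down_inj this
    subst h1 h2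
    rfl
  · rintro ⟨⟨f, hf⟩, hS⟩
    simp only at hS
    have ha : ∀ m : {m // m ∈ S}, ∃ r, f m.1 = Sum.inl r := fun m =>
      Sum.isLeft_iff.1 ((hS m.1).1 m.2)
    have hb : ∀ m : {m // m ∉ S}, ∃ x : {m // m ∈ S} ⊕ {m // m ∉ S},
        f m.1 = Sum.inr (down x) := by
      intro m
      rcases h : f m.1 with r | y
      · exact absurd ((hS m.1).2 (by simp [h])) m.2
      · obtain ⟨x, hx⟩ := down_surj S y
        exact ⟨x, by rw [hx]⟩
    choose a ha using ha
    choose g hg using hb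
    have hglue : glue S a g = f := by
      funext m
      by_cases h : m ∈ S
      · simp [glue, h, ha ⟨m, h⟩]
      · simp [glue, h, hg ⟨m, h⟩]
    refine ⟨⟨a, g, fun m => ?_⟩, ?_⟩
    · rw [glue_reach S a g, hglue]; exact hf _
    · simp [hglue]

theorem card_rec {R M : Type} [Finite R] [Fintype M] :
    Nat.card (Forest R M) = ∑ S : Finset M,
      Nat.card R ^ S.card * Nat.card (Forest {m // m ∈ S} {m // m ∉ S}) := by
  classical
  let F : Forest R M → Finset M := fun f => Finset.univ.filter fun m => (f.1 m).isLeft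
  rw [← Nat.card_congr (Equiv.sigmaFiberEquiv F), Nat.card_sigma]
  refine Finset.sum_congr rfl fun S _ => ?_
  rw [← card_fiber S]
  refine Nat.card_congr (Equiv.subtypeEquivRight fun f => ?_)
  simp only [F, Finset.ext_iff, Finset.mem_filter, Finset.mem_univ, true_and]
  exact forall_congr' fun m => Iff.comm

theorem sum_aux (m r b : ℕ) :
    ∑ s ∈ Finset.range (m + 2), (m + 1).choose s * (r ^ s * (s * b ^ (m + 1 - s))) =
      (m + 1) * r * (r + b) ^ m := by
  rw [Finset.sum_range_succ', add_pow, Finset.mul_sum]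
  simp only [zero_mul, mul_zero, add_zero]
  refine Finset.sum_congr rfl fun s hs => ?_
  have := Nat.add_one_mul_choose_eq m s
  have h2 : m + 1 - (s + 1) = m - s := by omega
  rw [h2, pow_succ, Nat.cast_id]
  calc _ = ((m + 1).choose (s + 1) * (s + 1)) * (r ^ s * r * b ^ (m - s)) := by ring
    _ = _ := by rw [← this]; ring

theorem card_forest (m : ℕ) : ∀ (R M : Type) [Finite R] [Finite M], Nat.card M = m →
    Nat.card (Forest R M) * (Nat.card R + m) = Nat.card R * (Nat.card R + m) ^ m := by
  induction m using Nat.strong_induction_on with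
  | _ m ih =>
  intro R M _ _ hM
  classical
  have := Fintype.ofFinite M
  have hM' : Fintype.card M = m := by rw [← hM, Nat.card_eq_fintype_card]
  rcases m with _ | m
  · have : IsEmpty M := by rwa [← Fintype.card_eq_zero_iff]
    have : Nat.card (Forest R M) = 1 := by
      rw [Nat.card_eq_one_iff_unique]
      exact ⟨⟨fun a b => Subtype.ext (funext fun m => isEmptyElim m)⟩,
        ⟨⟨fun m => isEmptyElim m, fun m => isEmptyElim m⟩⟩⟩
    rw [this]; simp
  by_cases hR : Nat.card R = 0
  · have : IsEmpty (Forest R M) := by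
      have hR' : IsEmpty R := (Finite.card_eq_zero_iff).1 hR
      constructor
      rintro ⟨f, hf⟩
      have : Nonempty M := by rw [← Fintype.card_pos_iff]; omega
      obtain ⟨x⟩ := this
      have := hf x
      induction this with
      | base m r h => exact hR'.elim r
      | step _ _ _ _ ih => exact ih
    simp [hR]
  have key : Nat.card (Forest R M) * (m + 1) =
      (m + 1) * Nat.card R * (Nat.card R + (m + 1)) ^ m := by
    rw [← sum_aux, card_rec, Finset.sum_mul]
    have h := Finset.sum_powerset_apply_card (x := (Finset.univ : Finset M))
      (fun s => Nat.card R ^ s * (s * (m + 1) ^ (m + 1 - s)))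
    simp only [Finset.powerset_univ, Finset.card_univ, hM', smul_eq_mul] at h
    rw [← h]
    refine Finset.sum_congr rfl fun S _ => ?_
    rw [mul_assoc]
    congr 1
    have hle : S.card ≤ m + 1 := hM' ▸ Finset.card_le_univ S
    have hc : Nat.card {x // x ∉ S} = m + 1 - S.card := by
      rw [Nat.card_eq_fintype_card, Fintype.card_subtype_compl]; simp [hM']
    by_cases h0 : S.card = 0
    · have hS : S = ∅ := Finset.card_eq_zero.1 h0
      subst hS
      have : IsEmpty (Forest {x // x ∈ (∅ : Finset M)} {x // x ∉ (∅ : Finset M)}) := by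
        constructor
        rintro ⟨f, hf⟩
        have : Nonempty M := by rw [← Fintype.card_pos_iff]; omega
        obtain ⟨x⟩ := this
        have hall : ∀ y, Reach f y → False := by
          intro y hy
          induction hy with
          | base m r h => exact absurd r.2 (Finset.notMem_empty _)
          | step _ _ _ _ ih => exact ih
        exact hall ⟨x, by simp⟩ (hf _)
      rw [Nat.card_of_isEmpty]; simp
    · have := ih (m + 1 - S.card) (by omega) {x // x ∈ S} {x // x ∉ S} hc
      have hs : Nat.card {x // x ∈ S} = S.card := by simp
      rw [hs, show S.card + (m + 1 - S.card) = m + 1 by omega] at this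
      exact this
  have key2 : Nat.card (Forest R M) = Nat.card R * (Nat.card R + (m + 1)) ^ m := by
    apply Nat.eq_of_mul_eq_mul_right (Nat.succ_pos m)
    rw [Nat.succ_eq_add_one, key]; ring
  rw [key2, pow_succ]; ring

theorem no_two_cycle {R M : Type} {f : M → R ⊕ M} {m : M} (h : Reach f m) :
    ∀ m', f m = Sum.inr m' → f m' ≠ Sum.inr m := by
  induction h with
  | base m r h => intro m' h'; simp [h] at h'
  | step m m' h h' ih =>
    intro m'' h1 h2
    rw [h] at h1
    cases h1
    exact ih m h2 h

/-- The graph of a parent function. -/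
def gr {M : Type} (f : M → Unit ⊕ M) : SimpleGraph (Unit ⊕ M) :=
  SimpleGraph.fromRel fun a b => ∃ m, a = Sum.inr m ∧ b = f m

theorem gr_adj_self {M : Type} {f : M → Unit ⊕ M} (hf : ∀ m, Reach f m) (m : M) :
    (gr f).Adj (Sum.inr m) (f m) := by
  rw [gr, SimpleGraph.fromRel_adj]
  refine ⟨fun h => no_two_cycle (hf m) m h.symm h.symm, Or.inl ⟨m, rfl, rfl⟩⟩

theorem gr_connected {M : Type} {f : M → Unit ⊕ M} (hf : ∀ m, Reach f m) :
    (gr f).Connected := by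
  have key : ∀ a, (gr f).Reachable a (Sum.inl ()) := by
    rintro (⟨⟩ | m)
    · exact SimpleGraph.Reachable.refl _
    · have := hf m
      induction this with
      | base m r h =>
        have := gr_adj_self hf m
        rw [h] at this
        exact this.reachable
      | step m m' h h' ih =>
        have := gr_adj_self hf m
        rw [h] at this
        exact this.reachable.trans ih
  exact { preconnected := fun a b => (key a).trans (key b).symm, nonempty := ⟨Sum.inl ()⟩ }

theorem gr_isTree {M : Type} [Finite M] {f : M → Unit ⊕ M} (hf : ∀ m, Reach f m) :
    (gr f).IsTree := by
  have hc := gr_connected hf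
  rw [SimpleGraph.isTree_iff_connected_and_card]
  refine ⟨hc, le_antisymm ?_ hc.card_vert_le_card_edgeSet_add_one⟩
  have hsub : (gr f).edgeSet ⊆ Set.range fun m => s(Sum.inr m, f m) := by
    intro e
    induction e using Sym2.ind with
    | _ a b =>
    rw [SimpleGraph.mem_edgeSet, gr, SimpleGraph.fromRel_adj]
    rintro ⟨_, ⟨m, rfl, rfl⟩ | ⟨m, rfl, rfl⟩⟩
    · exact ⟨m, rfl⟩
    · exact ⟨m, Sym2.eq_swap⟩
  have h1 : Nat.card (gr f).edgeSet ≤ Nat.card M := by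
    refine (Nat.card_mono (Set.finite_range _) hsub).trans ?_
    exact Finite.card_range_le _
  rw [Nat.card_sum, Nat.card_unique (α := Unit)]
  omega

theorem gr_inj {M : Type} {f g : M → Unit ⊕ M} (hf : ∀ m, Reach f m)
    (h : gr f = gr g) : f = g := by
  funext m
  have aux : ∀ m, f m = g m ∨ ∃ u, f m = Sum.inr u ∧ g u = Sum.inr m := by
    intro m
    have := gr_adj_self hf m
    rw [h, gr, SimpleGraph.fromRel_adj] at this
    obtain ⟨_, ⟨u, h1, h2⟩ | ⟨u, h1, h2⟩⟩ := this
    · cases h1; exact Or.inl h2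
    · exact Or.inr ⟨u, h1, h2.symm⟩
  have := hf m
  induction this with
  | base m r h =>
    rcases aux m with h1 | ⟨u, h1, h2⟩
    · exact h1
    · simp [h] at h1
  | step m m' h h' ih =>
    rcases aux m with h1 | ⟨u, h1, h2⟩
    · exact h1
    · rw [h] at h1; cases h1
      rw [← ih] at h2
      exact absurd h2 (no_two_cycle (hf m) m' h)

theorem gr_surj {M : Type} {T : SimpleGraph (Unit ⊕ M)} (hT : T.IsTree) :
    ∃ f : M → Unit ⊕ M, (∀ m, Reach f m) ∧ gr f = T := by
  have hex : ∀ m : M, ∃ y, T.Adj (Sum.inr m) y ∧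
      T.dist y (Sum.inl ()) < T.dist (Sum.inr m) (Sum.inl ()) := by
    intro m
    obtain ⟨p, hp⟩ := (hT.1.preconnected (Sum.inr m) (Sum.inl ())).exists_walk_length_eq_dist
    cases p with
    | cons h q =>
      refine ⟨_, h, ?_⟩
      rw [← hp]
      exact lt_of_le_of_lt (SimpleGraph.dist_le q) (by simp)
  choose f hadj hdist using hex
  have hf : ∀ m, Reach f m := by
    suffices ∀ d m, T.dist (Sum.inr m) (Sum.inl ()) = d → Reach f m from fun m => this _ m rfl
    intro d
    induction d using Nat.strong_induction_on with
    | _ d ih =>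
    intro m hm
    have := hdist m
    rcases h : f m with r | m'
    · exact Reach.base m r h
    · rw [h, hm] at this
      exact Reach.step m m' h (ih _ this m' rfl)
  refine ⟨f, hf, ?_⟩
  have hle : gr f ≤ T := by
    intro a b hab
    rw [gr, SimpleGraph.fromRel_adj] at hab
    obtain ⟨_, ⟨m, rfl, rfl⟩ | ⟨m, rfl, rfl⟩⟩ := hab
    · exact hadj m
    · exact (hadj m).symm
  exact ((SimpleGraph.isTree_iff_minimal_connected.1 hT).eq_of_le (gr_connected hf) hle)

theorem cayley_sum (M : Type) [Finite M] :
    Nat.card {T : SimpleGraph (Unit ⊕ M) // T.IsTree} * (Nat.card M + 1) =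
      (Nat.card M + 1) ^ Nat.card M := by
  have h := card_forest (Nat.card M) Unit M rfl
  rw [Nat.card_unique (α := Unit), one_mul, add_comm 1] at h
  rw [← h]
  congr 1
  symm
  refine Nat.card_eq_of_bijective (fun f => ⟨gr f.1, gr_isTree f.2⟩) ⟨?_, ?_⟩
  · rintro ⟨f, hf⟩ ⟨g, hg⟩ h
    exact Subtype.ext (gr_inj hf (congrArg Subtype.val h))
  · rintro ⟨T, hT⟩
    obtain ⟨f, hf, rfl⟩ := gr_surj hT
    exact ⟨⟨f, hf⟩, rfl⟩

theorem cayley (W : Type) [Finite W] (k : ℕ) (hk : 1 ≤ k) (hW : Nat.card W = k) :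
    Nat.card {T : SimpleGraph W // T.IsTree} * k = k ^ (k - 1) := by
  obtain ⟨k, rfl⟩ : ∃ j, k = j + 1 := ⟨k - 1, by omega⟩
  have h := cayley_sum (Fin k)
  simp only [Nat.card_fin] at h
  have e : W ≃ Unit ⊕ Fin k := by
    apply (Finite.card_eq).1 _ |>.some
    rw [hW]; simp [add_comm]
  rw [Nat.add_sub_cancel, ← h]
  congr 1
  refine Nat.card_congr (Equiv.subtypeEquiv e.simpleGraph fun T => ?_)
  exact (SimpleGraph.Iso.comap e.symm T).isTree_iff.symm

instance finite_config (n : ℕ) : Finite (GConfig n) := by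
  refine Finite.of_injective
    (fun c : GConfig n => (c.V, c.root, c.tree, c.arc)) ?_
  rintro ⟨⟩ ⟨⟩ h
  simp only [Prod.mk.injEq] at h
  obtain ⟨rfl, rfl, rfl, rfl⟩ := h
  rfl

/-- Configurations with a fixed tree vertex set. -/
theorem card_fixed {n : ℕ} (r : Fin n) (V : Finset (Fin n)) (hr : r ∈ V) :
    Nat.card {c : GConfig n // c.root = r ∧ c.V = V} =
      Nat.card {T : SimpleGraph {v // v ∈ V} // T.IsTree} *
        Nat.card ({v // v ∉ V} ↪ {v // v ≠ r}) := by
  classical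
  rw [← Nat.card_prod]
  have hc : ∀ T : SimpleGraph {v // v ∈ V}, T.IsTree → ∀ v ∈ V, ∀ w ∈ V,
      (T.map (Function.Embedding.subtype _)).Reachable v w := by
    intro T hT v hv w hw
    exact (hT.1.preconnected ⟨v, hv⟩ ⟨w, hw⟩).map
      (SimpleGraph.Embedding.map (Function.Embedding.subtype _) T).toHom
  have hac : ∀ T : SimpleGraph {v // v ∈ V}, T.IsTree →
      (T.map (Function.Embedding.subtype _)).IsAcyclic := by
    intro T hT v c hcyc
    have hadj : ∀ a b, (T.map (Function.Embedding.subtype _)).Adj a b → a ∈ V ∧ b ∈ V := by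
      intro a b h
      rw [SimpleGraph.map_adj] at h
      obtain ⟨a, b, _, rfl, rfl⟩ := h
      exact ⟨a.2, b.2⟩
    have hsup : ∀ a b (p : (T.map (Function.Embedding.subtype _)).Walk a b), a ∈ V →
        ∀ x ∈ p.support, x ∈ (V : Set (Fin n)) := by
      intro a b p
      induction p with
      | nil => intro ha x hx; simp at hx; subst hx; exact ha
      | cons h q ih =>
        intro ha x hx
        rw [SimpleGraph.Walk.support_cons, List.mem_cons] at hx
        rcases hx with rfl | hx
        · exact ha
        · exact ih (hadj _ _ h).2 x hx
    have hv : v ∈ V := by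
      cases c with
      | nil => exact absurd hcyc SimpleGraph.Walk.not_isCycle_nil
      | cons h q => exact (hadj _ _ h).1
    have hs := hsup _ _ c hv
    rw [← SimpleGraph.Walk.map_induce (s := (V : Set (Fin n))) c hs] at hcyc
    have h2 := hcyc.of_map
    have h3 : (T.map (Function.Embedding.subtype _)).induce (V : Set (Fin n)) = T :=
      SimpleGraph.comap_map_eq (Function.Embedding.subtype _) T
    have h4 : ((T.map (Function.Embedding.subtype _)).induce (V : Set (Fin n))).IsAcyclic := by
      rw [h3]; exact hT.2
    exact h4 _ h2
  symm
  refine Nat.card_eq_of_bijective (fun x => ⟨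
    { V := V
      root := r
      hroot := hr
      tree := x.1.1.map (Function.Embedding.subtype _)
      hedge := ?_
      hconn := hc _ x.1.2
      hacyc := hac _ x.1.2
      arc := fun v => if h : v ∈ V then v else (x.2 ⟨v, h⟩).1
      harcV := ?_
      harc := ?_
      hinj := ?_ }, rfl, rfl⟩) ⟨?_, ?_⟩
  · rintro v w h
    rw [SimpleGraph.map_adj] at h
    obtain ⟨a, b, _, rfl, rfl⟩ := h
    exact ⟨a.2, b.2⟩
  · intro v hv; simp [hv]
  · intro v hv; simpa [hv] using (x.2 ⟨v, hv⟩).2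
  · intro v w hv hw h
    simp only [hv, hw, dite_false] at h
    have := x.2.injective (Subtype.ext h)
    exact congrArg Subtype.val this
  · rintro ⟨⟨T, hT⟩, g⟩ ⟨⟨T', hT'⟩, g'⟩ h
    simp only [Subtype.mk.injEq, GConfig.mk.injEq, true_and] at h
    obtain ⟨h1, h2⟩ := h
    have h1 := SimpleGraph.map_injective _ h1
    have h2 : g = g' := by
      ext v
      have := congrFun h2 v.1
      simp only [v.2, dite_false] at this
      exact congrArg Fin.val this
    subst h1 h2
    rfl
  · rintro ⟨⟨V', r', hroot, T, hedge, hconn, hacyc, arc, harcV, harc, hinj⟩, h1, h2⟩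
    simp only at h1 h2
    subst h1 h2
    have hmap : (T.induce {v | v ∈ V'}).map (Function.Embedding.subtype _) = T := by
      ext a b
      rw [SimpleGraph.map_adj]
      constructor
      · rintro ⟨a, b, h, rfl, rfl⟩; exact h
      · intro h
        exact ⟨⟨a, (hedge _ _ h).1⟩, ⟨b, (hedge _ _ h).2⟩, h, rfl, rfl⟩
    have htree : (T.induce {v | v ∈ V'}).IsTree := by
      refine ⟨{ preconnected := ?_, nonempty := ⟨⟨r', hroot⟩⟩ }, hacyc.induce _⟩
      rintro ⟨a, ha⟩ ⟨b, hb⟩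
      obtain ⟨p⟩ := hconn a ha b hb
      induction p with
      | nil => exact SimpleGraph.Reachable.refl _
      | cons h q ih =>
        have hm := (hedge _ _ h).2
        refine SimpleGraph.Reachable.trans (SimpleGraph.Adj.reachable ?_) (ih hm hb)
        exact h
    refine ⟨⟨⟨T.induce {v | v ∈ V'}, htree⟩,
      ⟨fun v => ⟨arc v.1, harc _ v.2⟩, fun v w h => ?_⟩⟩, ?_⟩
    · exact Subtype.ext (hinj _ _ v.2 w.2 (congrArg Subtype.val h))
    · apply Subtype.ext
      simp only [GConfig.mk.injEq, true_and]
      refine ⟨hmap, ?_⟩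
      funext v
      by_cases h : v ∈ V'
      · simp [h, harcV v h]
      · simp only [h, dite_false]; rfl

end GC

/-- For `1 ≤ k ≤ n`, the number of `G`-configurations of size `n` (root `1`) with exactly
`k` tree vertices equals `(1/n) · C(n,k) · k^{k-1} · (n-1)!/(k-1)!`. -/
theorem stmt5 (n k : ℕ) (hn : 0 < n) (hk : 1 ≤ k) (hkn : k ≤ n) :
    Nat.card {c : GConfig n // c.root = ⟨0, hn⟩ ∧ c.V.card = k} * n =
      n.choose k * k ^ (k - 1) * ((n - 1).factorial / (k - 1).factorial) := by
  classical
  set r : Fin n := ⟨0, hn⟩ with hr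
  let A := {V : Finset (Fin n) // r ∈ V ∧ V.card = k}
  let F : {c : GConfig n // c.root = r ∧ c.V.card = k} → A :=
    fun c => ⟨c.1.V, by have := c.1.hroot; rwa [c.2.1] at this, c.2.2⟩
  have hfin : ∀ V : A, Nat.card {c // F c = V} * k =
      k ^ (k - 1) * ((n - 1).factorial / (k - 1).factorial) := by
    rintro ⟨V, hV, hVk⟩
    have e : Nat.card {c // F c = ⟨V, hV, hVk⟩} =
        Nat.card {c : GConfig n // c.root = r ∧ c.V = V} := by
      refine Nat.card_congr
        { toFun := fun c => ⟨c.1.1, c.1.2.1, congrArg Subtype.val c.2⟩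
          invFun := fun c => ⟨⟨c.1, c.2.1, by rw [c.2.2, hVk]⟩, Subtype.ext c.2.2⟩
          left_inv := fun c => rfl
          right_inv := fun c => rfl }
    have hemb : Nat.card ({v // v ∉ V} ↪ {v // v ≠ r}) =
        (n - 1).factorial / (k - 1).factorial := by
      rw [Nat.card_eq_fintype_card, Fintype.card_embedding_eq, Fintype.card_subtype_compl,
        Fintype.card_subtype_compl]
      simp only [Fintype.card_fin, Fintype.card_coe, hVk, Fintype.card_unique]
      rw [Nat.descFactorial_eq_div (by omega)]
      congr 2
      omega
    rw [e, GC.card_fixed r V hV, hemb, mul_right_comm,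
      GC.cayley {v // v ∈ V} k hk (by simp [hVk])]
  have hA : Nat.card A = (n - 1).choose (k - 1) := by
    have h := Finset.card_filter_powersetCard_subset {r} (Finset.univ : Finset (Fin n)) k
      (by simp) (by simpa using hk)
    simp only [Finset.card_univ, Fintype.card_fin, Finset.card_singleton] at h
    rw [← h, Nat.card_eq_fintype_card]
    refine Fintype.card_of_subtype _ fun V => ?_
    simp [Finset.mem_powersetCard, and_comm]
  have hc : Nat.card {c : GConfig n // c.root = r ∧ c.V.card = k} * k =
      (n - 1).choose (k - 1) * (k ^ (k - 1) * ((n - 1).factorial / (k - 1).factorial)) := by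
    rw [← Nat.card_congr (Equiv.sigmaFiberEquiv F), Nat.card_sigma, Finset.sum_mul,
      Finset.sum_congr rfl fun V _ => hfin V, Finset.sum_const, Finset.card_univ,
      ← Nat.card_eq_fintype_card, hA, smul_eq_mul]
  have hch : n * (n - 1).choose (k - 1) = n.choose k * k := by
    have := Nat.add_one_mul_choose_eq (n - 1) (k - 1)
    rwa [Nat.sub_add_cancel hn, Nat.sub_add_cancel hk] at this
  apply Nat.eq_of_mul_eq_mul_right hk
  calc _ = (Nat.card {c : GConfig n // c.root = r ∧ c.V.card = k} * k) * n := by ring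
    _ = (n * (n - 1).choose (k - 1)) *
      (k ^ (k - 1) * ((n - 1).factorial / (k - 1).factorial)) := by rw [hc]; ring
    _ = _ := by rw [hch]; ring
end

section
/- The total weight \sum (-1)^{n-|V(G)|} over all G-configurations G of size n equals the number of lone-child-avoiding rooted trees on [n] with root 1, where V(G) is the set of tree vertices of G. -/
/-- `p` is the parent function of a tree rooted at `r`. -/
def IsRT {α : Type} (r : α) (p : α → α) : Prop :=
  p r = r ∧ ∃ d : α → ℕ, ∀ x, x ≠ r → d (p x) < d x

/-- `s` has exactly one child. -/
def Lone {α : Type} (r : α) (p : α → α) (s : α) : Prop := ∃! w, w ≠ r ∧ p w = s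

/-- Number of rooted trees in which all elements of `S` have a lone child. -/
noncomputable def NT (α : Type) (r : α) (S : Set α) : ℕ :=
  Nat.card {p : α → α // IsRT r p ∧ ∀ s ∈ S, Lone r p s}

theorem IsRT.conj {α β : Type} (e : α ≃ β) (r : α) (p : α → α) (h : IsRT r p) :
    IsRT (e r) (e ∘ p ∘ e.symm) := by
  obtain ⟨h1, d, hd⟩ := h
  refine ⟨by simp [h1], d ∘ e.symm, fun x hx => ?_⟩
  have := hd (e.symm x) (by rintro h; apply hx; rw [← h]; simp)
  simpa using this

theorem Lone.conj {α β : Type} (e : α ≃ β) (r : α) (p : α → α) (s : α) (h : Lone r p s) :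
    Lone (e r) (e ∘ p ∘ e.symm) (e s) := by
  obtain ⟨w, ⟨h1, h2⟩, h3⟩ := h
  refine ⟨e w, ⟨by simpa using h1, by simp [h2]⟩, ?_⟩
  rintro y ⟨hy1, hy2⟩
  have := h3 (e.symm y) ⟨by rintro h; apply hy1; rw [← h]; simp, by simpa using hy2⟩
  rw [← this]; simp

theorem NT_congr {α β : Type} (e : α ≃ β) (r : α) (S : Set α) :
    NT α r S = NT β (e r) (e '' S) := by
  unfold NT
  refine Nat.card_congr ⟨fun p => ⟨e ∘ p.1 ∘ e.symm, p.2.1.conj e, ?_⟩,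
    fun q => ⟨e.symm ∘ q.1 ∘ e, ?_, ?_⟩, ?_, ?_⟩
  · rintro _ ⟨s, hs, rfl⟩
    exact (p.2.2 s hs).conj e
  · simpa using q.2.1.conj e.symm
  · intro s hs
    simpa using (q.2.2 (e s) ⟨s, hs, rfl⟩).conj e.symm
  · intro p; ext x; simp
  · intro p; ext x; simp

/-- Subdivide the edge above `c` with the new vertex `none`. -/
def subdiv {β : Type} [DecidableEq β] (c : β) (q : β → β) : Option β → Option β
  | none => some (q c)
  | some x => if x = c then none else some (q x)

theorem subdiv_lone_none {β : Type} [DecidableEq β] (r c : β) (hc : c ≠ r) (q : β → β) :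
    Lone (some r) (subdiv c q) none := by
  refine ⟨some c, ⟨by simpa using hc, by simp [subdiv]⟩, ?_⟩
  rintro (_ | y) ⟨h1, h2⟩
  · simp [subdiv] at h2
  · by_cases h : y = c
    · rw [h]
    · simp [subdiv, h] at h2

theorem subdiv_isRT {β : Type} [DecidableEq β] (r c : β) (hc : c ≠ r) (q : β → β)
    (h : IsRT r q) : IsRT (some r) (subdiv c q) := by
  obtain ⟨h1, d, hd⟩ := h
  refine ⟨by simp [subdiv, hc.symm, h1], fun o => o.elim (2 * d c - 1) (fun x => 2 * d x), ?_⟩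
  have hdc := hd c hc
  rintro (_ | y) hy
  · simp [subdiv]; omega
  · by_cases h : y = c
    · simp [subdiv, h]; omega
    · have := hd y (by simpa using hy)
      simp [subdiv, h]; omega

theorem subdiv_lone {β : Type} [DecidableEq β] (r c : β) (hc : c ≠ r) (q : β → β) (s : β) :
    Lone (some r) (subdiv c q) (some s) ↔ Lone r q s := by
  constructor
  · rintro ⟨w, ⟨h1, h2⟩, h3⟩
    rcases w with _ | w
    · refine ⟨c, ⟨hc, by simpa [subdiv] using h2⟩, ?_⟩
      rintro y ⟨hy1, hy2⟩
      by_contra hne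
      have := h3 (some y) ⟨by simpa using hy1, by simp [subdiv, hne, hy2]⟩
      simp at this
    · by_cases hwc : w = c
      · simp [subdiv, hwc] at h2
      refine ⟨w, ⟨by simpa using h1, by simpa [subdiv, hwc] using h2⟩, ?_⟩
      rintro y ⟨hy1, hy2⟩
      by_cases hyc : y = c
      · have := h3 none ⟨by simp, by simp [subdiv, ← hyc, hy2]⟩
        simp at this
      · have := h3 (some y) ⟨by simpa using hy1, by simp [subdiv, hyc, hy2]⟩
        simpa using this
  · rintro ⟨w, ⟨h1, h2⟩, h3⟩
    by_cases hwc : w = c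
    · refine ⟨none, ⟨by simp, by simp [subdiv, ← hwc, h2]⟩, ?_⟩
      rintro (_ | y) ⟨hy1, hy2⟩
      · rfl
      · by_cases hyc : y = c
        · simp [subdiv, hyc] at hy2
        · have := h3 y ⟨by simpa using hy1, by simpa [subdiv, hyc] using hy2⟩
          exact absurd (this.trans hwc) hyc
    · refine ⟨some w, ⟨by simpa using h1, by simp [subdiv, hwc, h2]⟩, ?_⟩
      rintro (_ | y) ⟨hy1, hy2⟩
      · have := h3 c ⟨hc, by simpa [subdiv] using hy2⟩
        exact absurd this.symm hwc
      · by_cases hyc : y = c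
        · simp [subdiv, hyc] at hy2
        · rw [h3 y ⟨by simpa using hy1, by simpa [subdiv, hyc] using hy2⟩]

theorem exists_subdiv {β : Type} [DecidableEq β] (r : β) (p : Option β → Option β)
    (h : IsRT (some r) p) (hl : Lone (some r) p none) :
    ∃ c q, c ≠ r ∧ IsRT r q ∧ subdiv c q = p := by
  obtain ⟨h1, d, hd⟩ := h
  obtain ⟨w, ⟨hw1, hw2⟩, hw3⟩ := hl
  have hnn : p none ≠ none := by
    intro h
    have := hd none (by simp)
    rw [h] at this
    omega
  rcases w with _ | c
  · exact absurd hw2 hnn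
  have hc : c ≠ r := by simpa using hw1
  have hsome : ∀ x, x ≠ c → p (some x) ≠ none := by
    intro x hx h
    by_cases hxr : x = r
    · rw [hxr, h1] at h; simp at h
    · have := hw3 (some x) ⟨by simpa using hxr, h⟩
      exact hx (by simpa using this)
  have hp : subdiv c (fun x => if x = c then (p none).getD r else (p (some x)).getD r) = p := by
    funext o
    rcases o with _ | x
    · obtain ⟨y, hy⟩ := Option.ne_none_iff_exists'.1 hnn
      simp [subdiv, hy]
    · by_cases hx : x = c
      · simp [subdiv, hx, hw2]
      · obtain ⟨y, hy⟩ := Option.ne_none_iff_exists'.1 (hsome x hx)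
        simp [subdiv, hx, hy]
  refine ⟨c, _, hc, ⟨?_, d ∘ some, ?_⟩, hp⟩
  · simp [hc.symm, h1]
  · intro x hx
    by_cases hxc : x = c
    · subst hxc
      have h3 := hd none (by simp)
      have h4 := hd (some x) (by simpa using hx)
      obtain ⟨y, hy⟩ := Option.ne_none_iff_exists'.1 hnn
      rw [hw2] at h4
      rw [hy] at h3
      simp [hy]; omega
    · have h4 := hd (some x) (by simpa using hx)
      obtain ⟨y, hy⟩ := Option.ne_none_iff_exists'.1 (hsome x hxc)
      rw [hy] at h4
      simpa [hxc, hy] using h4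

theorem subdiv_inj {β : Type} [DecidableEq β] (c c' : β) (q q' : β → β)
    (h : subdiv c q = subdiv c' q') : c = c' ∧ q = q' := by
  have hc : c = c' := by
    have := congrFun h (some c)
    by_contra hne
    simp [subdiv, hne] at this
  subst hc
  refine ⟨rfl, ?_⟩
  funext x
  by_cases hx : x = c
  · have := congrFun h none
    simpa [subdiv, hx] using this
  · have := congrFun h (some x)
    simpa [subdiv, hx] using this

theorem NT_option {β : Type} [Fintype β] (r : β) (S : Set β) :
    NT (Option β) (some r) (insert none (some '' S)) = (Fintype.card β - 1) * NT β r S := by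
  classical
  have hcard : Fintype.card β - 1 = Nat.card {c : β // c ≠ r} := by
    rw [Nat.card_eq_fintype_card, Fintype.card_subtype_compl]; simp
  rw [hcard]
  unfold NT
  rw [← Nat.card_prod]
  symm
  refine Nat.card_congr (Equiv.ofBijective (fun x => ⟨subdiv x.1.1 x.2.1,
    subdiv_isRT r _ x.1.2 _ x.2.2.1, ?_⟩) ⟨?_, ?_⟩)
  · rintro s (rfl | ⟨s, hs, rfl⟩)
    · exact subdiv_lone_none r _ x.1.2 _
    · exact (subdiv_lone r _ x.1.2 _ s).2 (x.2.2.2 s hs)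
  · rintro ⟨⟨c, hc⟩, ⟨q, hq⟩⟩ ⟨⟨c', hc'⟩, ⟨q', hq'⟩⟩ h
    obtain ⟨h1, h2⟩ := subdiv_inj c c' q q' (by simpa using h)
    subst h1; subst h2; rfl
  · rintro ⟨p, hp1, hp2⟩
    obtain ⟨c, q, hc, hq, rfl⟩ := exists_subdiv r p hp1 (hp2 none (by simp))
    exact ⟨⟨⟨c, hc⟩, ⟨q, hq, fun s hs => (subdiv_lone r c hc q s).1
      (hp2 (some s) (Or.inr ⟨s, hs, rfl⟩))⟩⟩, rfl⟩

/-- Put the new root `none` above the root `c`. -/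
def addRoot {β : Type} [DecidableEq β] (c : β) (q : β → β) : Option β → Option β
  | none => none
  | some x => if x = c then none else some (q x)

theorem NT_root {β : Type} [Fintype β] :
    NT (Option β) none {none} = ∑ c : β, NT β c ∅ := by
  classical
  unfold NT
  rw [← Nat.card_sigma]
  symm
  refine Nat.card_congr (Equiv.ofBijective (fun x => ⟨addRoot x.1 x.2.1, ⟨rfl, ?_⟩, ?_⟩) ⟨?_, ?_⟩)
  · obtain ⟨c, q, ⟨h1, d, hd⟩, h2⟩ := x
    refine ⟨fun o => o.elim 0 (fun x => d x + 1), ?_⟩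
    rintro (_ | y) hy
    · simp at hy
    · by_cases h : y = c
      · simp [addRoot, h]
      · have := hd y h
        simp [addRoot, h]; omega
  · rintro s rfl
    refine ⟨some x.1, ⟨by simp, by simp [addRoot]⟩, ?_⟩
    rintro (_ | y) ⟨h1, h2⟩
    · simp at h1
    · by_cases h : y = x.1
      · rw [h]
      · simp [addRoot, h] at h2
  · rintro ⟨c, q, ⟨h1, h2⟩, h3⟩ ⟨c', q', ⟨h1', h2'⟩, h3'⟩ h
    have h : addRoot c q = addRoot c' q' := by simpa using h
    have hc : c = c' := by
      have := congrFun h (some c)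
      by_contra hne
      simp [addRoot, hne] at this
    subst hc
    have hq : q = q' := by
      funext x
      by_cases hx : x = c
      · rw [hx, h1, h1']
      · have := congrFun h (some x)
        simpa [addRoot, hx] using this
    subst hq
    rfl
  · rintro ⟨p, ⟨h1, d, hd⟩, hp2⟩
    obtain ⟨w, ⟨hw1, hw2⟩, hw3⟩ := hp2 none rfl
    rcases w with _ | c
    · simp at hw1
    have hsome : ∀ x, x ≠ c → p (some x) ≠ none := by
      intro x hx h
      have := hw3 (some x) ⟨by simp, h⟩
      exact hx (by simpa using this)
    refine ⟨⟨c, fun x => if x = c then c else (p (some x)).getD c, ⟨by simp, d ∘ some, ?_⟩,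
      by simp⟩, ?_⟩
    · intro x hx
      have h4 := hd (some x) (by simp)
      obtain ⟨y, hy⟩ := Option.ne_none_iff_exists'.1 (hsome x hx)
      rw [hy] at h4
      simpa [hx, hy] using h4
    · apply Subtype.ext
      funext o
      rcases o with _ | x
      · simp [addRoot, h1]
      · by_cases hx : x = c
        · simp [addRoot, hx, hw2]
        · obtain ⟨y, hy⟩ := Option.ne_none_iff_exists'.1 (hsome x hx)
          simp [addRoot, hx, hy]

/-- Number of rooted trees on `k` vertices with given root. -/
noncomputable def tt : ℕ → ℕ
  | 0 => 0
  | k + 1 => NT (Fin (k + 1)) 0 ∅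

theorem NT_empty {α : Type} [Fintype α] (r : α) : NT α r ∅ = tt (Fintype.card α) := by
  classical
  obtain ⟨k, hk⟩ : ∃ k, Fintype.card α = k + 1 :=
    ⟨Fintype.card α - 1, by have := Fintype.card_pos_iff.2 ⟨r⟩; omega⟩
  rw [hk]
  let e := Fintype.equivFinOfCardEq hk
  rw [NT_congr (e.trans (Equiv.swap (e r) 0))]
  simp [tt]

theorem NT_option_equiv {α : Type} [Fintype α] (s r : α) (hs : s ≠ r) (S : Set α) (hS : s ∉ S) :
    ∃ (β : Type) (_ : Fintype β) (r' : β) (S' : Set β) (f : β → α), Function.Injective f ∧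
      f r' = r ∧ f '' S' = S ∧ Fintype.card α = Fintype.card β + 1 ∧
      NT α r (insert s S) = (Fintype.card β - 1) * NT β r' S' := by
  classical
  let e : Option {x : α // x ≠ s} ≃ α := Equiv.optionSubtypeNe s
  refine ⟨{x : α // x ≠ s}, inferInstance, ⟨r, hs.symm⟩, Subtype.val ⁻¹' S, Subtype.val,
    Subtype.val_injective, rfl, ?_, ?_, ?_⟩
  · ext x
    simp only [Set.mem_image, Set.mem_preimage, Subtype.exists]
    constructor
    · rintro ⟨a, _, h, rfl⟩; exact h
    · intro h; exact ⟨x, by rintro rfl; exact hS h, h, rfl⟩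
  · rw [← Fintype.card_option]; exact (Fintype.card_congr e).symm
  · rw [← NT_option, NT_congr e]
    congr 1
    rw [Set.image_insert_eq, Set.image_image]
    simp only [e, Equiv.optionSubtypeNe_none, Equiv.optionSubtypeNe_some]
    congr 1
    ext x
    simp only [Set.mem_image, Set.mem_preimage, Subtype.exists]
    constructor
    · intro h; exact ⟨x, by rintro rfl; exact hS h, h, rfl⟩
    · rintro ⟨a, _, h, rfl⟩; exact h

theorem NT_lone_root {α : Type} [Fintype α] (r : α) :
    NT α r {r} = (Fintype.card α - 1) * tt (Fintype.card α - 1) := by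
  classical
  let e : Option {x : α // x ≠ r} ≃ α := Equiv.optionSubtypeNe r
  have hc : Fintype.card α = Fintype.card {x : α // x ≠ r} + 1 := by
    rw [← Fintype.card_option]; exact (Fintype.card_congr e).symm
  have := NT_congr e none {none}
  simp only [Set.image_singleton, e, Equiv.optionSubtypeNe_none] at this
  rw [← this, NT_root]
  simp only [NT_empty, Finset.sum_const, hc, Finset.card_univ, smul_eq_mul]
  simp

theorem NT_formula (m : ℕ) : ∀ {α : Type} [Fintype α] (r : α) (S : Set α) (_ : r ∉ S)
    (_ : S.ncard = m),
    NT α r S = (Fintype.card α - 2).descFactorial m * tt (Fintype.card α - m) ∧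
    NT α r (insert r S) = (Fintype.card α - 2).descFactorial m *
      ((Fintype.card α - 1 - m) * tt (Fintype.card α - 1 - m)) := by
  induction m with
  | zero =>
    intro α _ r S hr hS
    have : S = ∅ := by rwa [Set.ncard_eq_zero] at hS
    subst this
    simp [NT_empty, NT_lone_root]
  | succ m ih =>
    intro α _ r S hr hS
    obtain ⟨s, T, hsT, rfl, hT⟩ := Set.eq_insert_of_ncard_eq_succ hS
    have hsr : s ≠ r := by rintro rfl; simp at hr
    have hrT : r ∉ T := fun h => hr (Or.inr h)
    constructor
    · obtain ⟨β, _, r', S', f, hf, rfl, rfl, hcard, hN⟩ := NT_option_equiv s r hsr T hsT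
      rw [Set.ncard_image_of_injective _ hf] at hT
      have hr' : r' ∉ S' := fun h => hrT ⟨_, h, rfl⟩
      rw [hN, (ih r' S' hr' hT).1, hcard, ← mul_assoc]
      congr 1
      · have : Fintype.card β + 1 - 2 = Fintype.card β - 1 := by omega
        rw [this]
        rcases hb : Fintype.card β - 1 with _ | b
        · simp
        · rw [Nat.succ_descFactorial_succ]
          congr 2
          omega
      · congr 1; omega
    · rw [Set.insert_comm]
      obtain ⟨β, _, r', S', f, hf, h1, h2, hcard, hN⟩ := NT_option_equiv s r hsr (insert r T)
        (by simp [hsr, hsT])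
      have hr' : r' ∈ S' := by
        have : f r' ∈ f '' S' := by rw [h1, h2]; simp
        exact (Function.Injective.mem_set_image hf).1 this
      have h3 : S' = insert r' (S' \ {r'}) := by simp [hr']
      have h4 : (S' \ {r'}).ncard = m := by
        rw [Set.ncard_sdiff_singleton_of_mem hr', ← Set.ncard_image_of_injective _ hf, h2,
          Set.ncard_insert_of_notMem hrT, hT]
        rfl
      rw [hN, h3, (ih r' (S' \ {r'}) (by simp) h4).2, hcard, ← mul_assoc]
      have h5 : Fintype.card β + 1 - 1 - (m + 1) = Fintype.card β - 1 - m := by omega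
      rw [h5]
      congr 1
      have : Fintype.card β + 1 - 2 = Fintype.card β - 1 := by omega
      rw [this]
      rcases hb : Fintype.card β - 1 with _ | b
      · simp
      · rw [Nat.succ_descFactorial_succ]
        congr 2
        omega

/-- The graph of a parent function. -/
def gr {α : Type} (p : α → α) : SimpleGraph α := SimpleGraph.fromRel (fun x y => p x = y)

theorem gr_adj {α : Type} (p : α → α) (x y : α) :
    (gr p).Adj x y ↔ x ≠ y ∧ (p x = y ∨ p y = x) := by
  simp [gr]

theorem IsRT.ne {α : Type} {r : α} {p : α → α} (h : IsRT r p) {x : α} (hx : x ≠ r) : p x ≠ x := by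
  obtain ⟨_, d, hd⟩ := h
  intro h
  have := hd x hx
  rw [h] at this
  omega

theorem IsRT.adj {α : Type} {r : α} {p : α → α} (h : IsRT r p) {x : α} (hx : x ≠ r) :
    (gr p).Adj x (p x) := (gr_adj _ _ _).2 ⟨(h.ne hx).symm, Or.inl rfl⟩

theorem IsRT.depth {α : Type} {r : α} {p : α → α} (h : IsRT r p) :
    ∃ e : α → ℕ, e r = 0 ∧ ∀ x, x ≠ r → e x = e (p x) + 1 := by
  classical
  obtain ⟨h1, d, hd⟩ := h
  have hk : ∀ m x, d x = m → ∃ k, p^[k] x = r := by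
    intro m
    induction m using Nat.strong_induction_on with
    | _ m ih =>
      intro x hx
      by_cases hxr : x = r
      · exact ⟨0, hxr⟩
      · obtain ⟨k, hk⟩ := ih (d (p x)) (hx ▸ hd x hxr) (p x) rfl
        exact ⟨k + 1, hk⟩
  have hk' : ∀ x, ∃ k, p^[k] x = r := fun x => hk _ x rfl
  refine ⟨fun x => Nat.find (hk' x), ?_, fun x hx => ?_⟩
  · simp [Nat.find_eq_zero]
  · exact Nat.find_comp_succ (hk' x) (hk' (p x)) (by simpa using hx)

theorem IsRT.reach {α : Type} {r : α} {p : α → α} (h : IsRT r p) (e : α → ℕ)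
    (he : ∀ x, x ≠ r → e x = e (p x) + 1) (m : ℕ) :
    ∀ x, e x = m → ∃ w : (gr p).Walk x r, w.length ≤ m := by
  induction m with
  | zero =>
    intro x hx
    by_cases hxr : x = r
    · subst hxr; exact ⟨.nil, by simp⟩
    · have := he x hxr; omega
  | succ m ih =>
    intro x hx
    by_cases hxr : x = r
    · subst hxr; exact ⟨.nil, by simp⟩
    · obtain ⟨w, hw⟩ := ih (p x) (by have := he x hxr; omega)
      exact ⟨.cons (h.adj hxr) w, by simpa using hw⟩

theorem IsRT.connected {α : Type} {r : α} {p : α → α} (h : IsRT r p) : (gr p).Connected := by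
  obtain ⟨e, h0, he⟩ := h.depth
  have : ∀ x, (gr p).Reachable x r := fun x => ⟨(h.reach e he _ x rfl).choose⟩
  have : Nonempty α := ⟨r⟩
  exact ⟨fun x y => (by assumption : ∀ x, (gr p).Reachable x r) x |>.trans
    ((by assumption : ∀ x, (gr p).Reachable x r) y).symm⟩

theorem IsRT.walk_le {α : Type} {r : α} {p : α → α} (h : IsRT r p) (e : α → ℕ) (h0 : e r = 0)
    (he : ∀ x, x ≠ r → e x = e (p x) + 1) {x y : α} (w : (gr p).Walk x y) :
    e x ≤ e y + w.length := by
  induction w with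
  | nil => simp
  | @cons u v y hadj w ih =>
    have hle : e u ≤ e v + 1 := by
      obtain ⟨hne, h2 | h2⟩ := (gr_adj _ _ _).1 hadj
      · by_cases hu : u = r
        · rw [hu, h0]; omega
        · rw [he u hu, h2]
      · by_cases hv : v = r
        · rw [hv, h.1] at h2
          exact absurd (h2.symm.trans hv.symm) hne
        · rw [he v hv, h2]; omega
    simp only [SimpleGraph.Walk.length_cons]
    omega

theorem IsRT.dist {α : Type} {r : α} {p : α → α} (h : IsRT r p) {x : α} (hx : x ≠ r) :
    (gr p).dist r x = (gr p).dist r (p x) + 1 := by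
  obtain ⟨e, h0, he⟩ := h.depth
  have key : ∀ x, (gr p).dist r x = e x := by
    intro x
    rw [SimpleGraph.dist_comm]
    apply le_antisymm
    · obtain ⟨w, hw⟩ := h.reach e he _ x rfl
      exact (SimpleGraph.dist_le w).trans hw
    · obtain ⟨w, hw⟩ := h.connected.exists_walk_length_eq_dist x r
      have := h.walk_le e h0 he w
      omega
  rw [key, key, he x hx]

theorem IsRT.isTree {α : Type} [Fintype α] {r : α} {p : α → α} (h : IsRT r p) :
    (gr p).IsTree := by
  classical
  rw [SimpleGraph.isTree_iff_connected_and_card]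
  refine ⟨h.connected, le_antisymm ?_ h.connected.card_vert_le_card_edgeSet_add_one⟩
  have hsub : (gr p).edgeSet ⊆ (fun x => s(x, p x)) '' {x | x ≠ r} := by
    intro e
    induction e using Sym2.ind with
    | _ x y =>
      intro hxy
      obtain ⟨hne, h2 | h2⟩ := (gr_adj _ _ _).1 hxy
      · refine ⟨x, ?_, by simp [h2]⟩
        rintro rfl
        exact hne (h.1.symm.trans h2)
      · refine ⟨y, ?_, by simp [h2, Sym2.eq_swap]⟩
        rintro rfl
        exact hne (h2.symm.trans h.1)
  have h1 := Set.ncard_le_ncard hsub (Set.toFinite _)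
  have h2 := Set.ncard_image_le (f := fun x => s(x, p x)) (Set.toFinite {x : α | x ≠ r})
  have h3 : ({x | x ≠ r} : Set α).ncard + 1 = Nat.card α := by
    have : ({x | x ≠ r} : Set α) = {r}ᶜ := rfl
    rw [this, Set.ncard_compl]
    simp
    have : 0 < Fintype.card α := Fintype.card_pos_iff.2 ⟨r⟩
    omega
  have h4 : Nat.card (gr p).edgeSet = (gr p).edgeSet.ncard := rfl
  omega

theorem IsRT.gr_inj {α : Type} {r : α} {p q : α → α} (hp : IsRT r p) (hq : IsRT r q)
    (h : gr p = gr q) : p = q := by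
  funext x
  by_cases hx : x = r
  · rw [hx, hp.1, hq.1]
  · have h1 := hp.adj hx
    have h2 := hp.dist hx
    rw [h] at h1 h2
    obtain ⟨hne, h3 | h3⟩ := (gr_adj _ _ _).1 h1
    · exact h3.symm
    · by_cases hr : p x = r
      · rw [hr, hq.1] at h3
        exact absurd h3.symm hx
      · have := hq.dist hr
        rw [h3] at this
        omega

theorem exists_gr {α : Type} [Fintype α] (r : α) (G : SimpleGraph α) (hG : G.IsTree) :
    ∃ p, IsRT r p ∧ gr p = G := by
  classical
  have key : ∀ x, x ≠ r → ∃ y, G.Adj x y ∧ G.dist r y < G.dist r x := by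
    intro x hx
    obtain ⟨w, hw⟩ := hG.connected.exists_walk_length_eq_dist x r
    cases w with
    | nil => exact absurd rfl hx
    | @cons _ y _ hadj w =>
      refine ⟨y, hadj, ?_⟩
      rw [SimpleGraph.dist_comm, SimpleGraph.dist_comm (u := r) (v := x), ← hw]
      have := SimpleGraph.dist_le w
      simp only [SimpleGraph.Walk.length_cons]
      omega
  choose! f hf using key
  have hRT : IsRT r (fun x => if x = r then r else f x) :=
    ⟨by simp, fun x => G.dist r x, fun x hx => by simpa [hx] using (hf x hx).2⟩
  refine ⟨_, hRT, ?_⟩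
  have hle : gr (fun x => if x = r then r else f x) ≤ G := by
    intro x y hxy
    obtain ⟨hne, h2 | h2⟩ := (gr_adj _ _ _).1 hxy
    · by_cases hx : x = r
      · simp [hx] at h2; exact absurd (hx.trans h2) hne
      · simp [hx] at h2; rw [← h2]; exact (hf x hx).1
    · by_cases hy : y = r
      · simp [hy] at h2; exact absurd (h2.symm.trans hy.symm) hne
      · simp [hy] at h2; rw [← h2]; exact (hf y hy).1.symm
  exact le_antisymm hle
    ((SimpleGraph.isTree_iff_minimal_connected.1 hG).2 hRT.connected hle)

/-- Trees correspond to parent functions. -/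
noncomputable def treeEquiv {α : Type} [Fintype α] (r : α) :
    {p : α → α // IsRT r p} ≃ {G : SimpleGraph α // G.IsTree} :=
  Equiv.ofBijective (fun p => ⟨gr p.1, p.2.isTree⟩) ⟨fun p q h => Subtype.ext
    (p.2.gr_inj q.2 (by simpa using h)), fun G => by
      obtain ⟨p, hp, h⟩ := exists_gr r G.1 G.2
      exact ⟨⟨p, hp⟩, Subtype.ext h⟩⟩

theorem card_trees {α : Type} [Fintype α] [Nonempty α] :
    Nat.card {G : SimpleGraph α // G.IsTree} = tt (Fintype.card α) := by
  obtain ⟨r⟩ := ‹Nonempty α›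
  rw [← NT_empty r, ← Nat.card_congr (treeEquiv r)]
  unfold NT
  simp

theorem children_gr {n : ℕ} {r : Fin n} {p : Fin n → Fin n} (h : IsRT r p) (v : Fin n) :
    children (gr p) r v = {w | w ≠ r ∧ p w = v} := by
  ext w
  simp only [children, Set.mem_ofPred_eq]
  constructor
  · rintro ⟨hadj, hd⟩
    have hw : w ≠ r := by rintro rfl; simp at hd
    refine ⟨hw, ?_⟩
    obtain ⟨hne, h2 | h2⟩ := (gr_adj _ _ _).1 hadj
    · by_cases hv : v = r
      · rw [hv, h.1] at h2; exact absurd h2.symm hw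
      · have := h.dist hv
        rw [h2] at this
        omega
    · exact h2
  · rintro ⟨hw, rfl⟩
    exact ⟨(h.adj hw).symm, h.dist hw⟩

theorem lone_iff {n : ℕ} {r : Fin n} {p : Fin n → Fin n} (h : IsRT r p) (v : Fin n) :
    (children (gr p) r v).ncard = 1 ↔ Lone r p v := by
  rw [children_gr h, Set.ncard_eq_one]
  unfold Lone
  constructor
  · rintro ⟨a, ha⟩
    refine ⟨a, ?_, fun y hy => ?_⟩
    · have : a ∈ ({a} : Set (Fin n)) := rfl
      rwa [← ha] at this
    · have : y ∈ {w | w ≠ r ∧ p w = v} := hy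
      rw [ha] at this
      exact this
  · rintro ⟨a, ha, h⟩
    exact ⟨a, Set.eq_singleton_iff_unique_mem.2 ⟨ha, h⟩⟩

theorem card_lca {n : ℕ} (r : Fin n) :
    (Nat.card {G : SimpleGraph (Fin n) // G.IsTree ∧ ∀ v, (children G r v).ncard ≠ 1} : ℤ) =
      ∑ S : Finset (Fin n), (-1) ^ S.card * (NT (Fin n) r S : ℤ) := by
  classical
  have h1 : Nat.card {G : SimpleGraph (Fin n) // G.IsTree ∧ ∀ v, (children G r v).ncard ≠ 1} =
      Nat.card {p : Fin n → Fin n // IsRT r p ∧ ∀ v, ¬ Lone r p v} := by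
    symm
    refine Nat.card_congr (Equiv.ofBijective (fun p => ⟨gr p.1, p.2.1.isTree, fun v hv =>
      p.2.2 v ((lone_iff p.2.1 v).1 hv)⟩) ⟨fun p q h => Subtype.ext
      (p.2.1.gr_inj q.2.1 (by simpa using h)), ?_⟩)
    rintro ⟨G, hG, hc⟩
    obtain ⟨p, hp, rfl⟩ := exists_gr r G hG
    exact ⟨⟨p, hp, fun v hv => hc v ((lone_iff hp v).2 hv)⟩, rfl⟩
  have h2 : ∀ S : Finset (Fin n), (NT (Fin n) r S : ℤ) =
      ∑ p : Fin n → Fin n with IsRT r p,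
        if S ⊆ Finset.univ.filter (Lone r p) then 1 else 0 := by
    intro S
    unfold NT
    rw [Nat.card_eq_fintype_card, Fintype.card_subtype, ← Finset.filter_filter, Finset.sum_boole]
    congr 3
    ext p
    simp [Finset.subset_iff]
  rw [h1, Nat.card_eq_fintype_card, Fintype.card_subtype, ← Finset.filter_filter]
  simp_rw [h2, Finset.mul_sum]
  rw [Finset.sum_comm, ← Finset.sum_boole]
  refine Finset.sum_congr rfl fun p _ => ?_
  have := Finset.sum_powerset_neg_one_pow_card (x := Finset.univ.filter (Lone r p))
  simp only [mul_ite, mul_one, mul_zero]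
  rw [← Finset.sum_filter]
  have h3 : Finset.univ.filter (fun S => S ⊆ Finset.univ.filter (Lone r p)) =
      (Finset.univ.filter (Lone r p)).powerset := by
    ext S; simp
  rw [h3, this]
  simp [Finset.filter_eq_empty_iff]

/-- `G` is a tree on the vertex set `V`. -/
def TreeOn {n : ℕ} (V : Finset (Fin n)) (G : SimpleGraph (Fin n)) : Prop :=
  (∀ v w, G.Adj v w → v ∈ V ∧ w ∈ V) ∧ (∀ v ∈ V, ∀ w ∈ V, G.Reachable v w) ∧ G.IsAcyclic

theorem walk_support {n : ℕ} (V : Finset (Fin n)) (G : SimpleGraph (Fin n))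
    (h : ∀ v w, G.Adj v w → v ∈ V ∧ w ∈ V) {x y : Fin n} (w : G.Walk x y) (hx : x ∈ V) :
    ∀ z ∈ w.support, z ∈ (V : Set (Fin n)) := by
  induction w with
  | nil => simpa using hx
  | @cons u v y hadj w ih =>
    intro z hz
    rw [SimpleGraph.Walk.support_cons, List.mem_cons] at hz
    rcases hz with rfl | hz
    · exact hx
    · exact ih (h _ _ hadj).2 z hz

theorem TreeOn_iff {n : ℕ} (V : Finset (Fin n)) (hV : V.Nonempty) (G : SimpleGraph (Fin n))
    (h : ∀ v w, G.Adj v w → v ∈ V ∧ w ∈ V) :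
    TreeOn V G ↔ (G.induce (V : Set (Fin n))).IsTree := by
  constructor
  · rintro ⟨-, h2, h3⟩
    have : Nonempty (V : Set (Fin n)) := by
      obtain ⟨x, hx⟩ := hV
      exact ⟨⟨x, hx⟩⟩
    refine ⟨⟨?_⟩, h3.induce _⟩
    rintro ⟨x, hx⟩ ⟨y, hy⟩
    obtain ⟨w⟩ := h2 x hx y hy
    exact ⟨w.induce _ (walk_support V G h w hx)⟩
  · rintro ⟨h2, h3⟩
    refine ⟨h, ?_, ?_⟩
    · intro v hv w hw
      exact (h2.preconnected ⟨v, hv⟩ ⟨w, hw⟩).map (SimpleGraph.Embedding.induce _).toHom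
    · intro x c hc
      have hx : x ∈ V := by
        cases c with
        | nil => simp at hc
        | cons hadj w => exact (h _ _ hadj).1
      have hs := walk_support V G h c hx
      apply h3 (c.induce _ hs)
      rw [← SimpleGraph.Walk.isCycle_map_iff_of_injective
        (f := (SimpleGraph.Embedding.induce (G := G) (V : Set (Fin n))).toHom)
        (SimpleGraph.Embedding.induce (G := G) (V : Set (Fin n))).injective]
      rw [SimpleGraph.Walk.map_induce]
      exact hc

theorem card_TreeOn {n : ℕ} (V : Finset (Fin n)) (hV : V.Nonempty) :
    Nat.card {G // TreeOn V G} = tt V.card := by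
  classical
  have : Nonempty (V : Set (Fin n)) := by
    obtain ⟨x, hx⟩ := hV
    exact ⟨⟨x, hx⟩⟩
  have hc : V.card = Fintype.card (V : Set (Fin n)) := by simp
  rw [hc, ← card_trees]
  have hsup : ∀ G : SimpleGraph (V : Set (Fin n)), ∀ v w, G.spanningCoe.Adj v w →
      v ∈ V ∧ w ∈ V := by
    intro G v w h
    rw [SimpleGraph.map_adj] at h
    obtain ⟨a, b, _, rfl, rfl⟩ := h
    exact ⟨a.2, b.2⟩
  refine Nat.card_congr ⟨fun G => ⟨G.1.induce _, (TreeOn_iff V hV G.1 G.2.1).1 G.2⟩,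
    fun G => ⟨G.1.spanningCoe, (TreeOn_iff V hV _ (hsup G.1)).2 ?_⟩, ?_, ?_⟩
  · rw [SimpleGraph.induce_spanningCoe]; exact G.2
  · rintro ⟨G, hG⟩
    apply Subtype.ext
    refine (SimpleGraph.spanningCoe_induce_eq_self _ _).2 ?_
    rintro v ⟨w, hw⟩
    exact (hG.1 _ _ hw).1
  · rintro ⟨G, hG⟩
    apply Subtype.ext
    exact SimpleGraph.induce_spanningCoe

/-- Arc maps. -/
def ArcOn {n : ℕ} (V : Finset (Fin n)) (r : Fin n) (arc : Fin n → Fin n) : Prop :=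
  (∀ v ∈ V, arc v = v) ∧ (∀ v, v ∉ V → arc v ≠ r) ∧
  (∀ v w, v ∉ V → w ∉ V → arc v = arc w → v = w)

theorem card_ArcOn {n : ℕ} (V : Finset (Fin n)) (r : Fin n) :
    Nat.card {a // ArcOn V r a} = (n - 1).descFactorial (n - V.card) := by
  classical
  have h1 : n - V.card = Fintype.card {v // v ∉ V} := by
    rw [Fintype.card_subtype_compl]; simp
  have h2 : n - 1 = Fintype.card {v : Fin n // v ≠ r} := by
    rw [Fintype.card_subtype_compl]; simp
  rw [h1, h2, ← Fintype.card_embedding_eq, ← Nat.card_eq_fintype_card]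
  refine Nat.card_congr ⟨fun a => ⟨fun v => ⟨a.1 v.1, a.2.2.1 _ v.2⟩, ?_⟩,
    fun f => ⟨fun v => if h : v ∈ V then v else (f ⟨v, h⟩).1, ?_, ?_, ?_⟩, ?_, ?_⟩
  · intro v w h
    exact Subtype.ext (a.2.2.2 _ _ v.2 w.2 (by simpa using h))
  · intro v hv; simp [hv]
  · intro v hv; simp only [hv, dite_false]; exact (f ⟨v, hv⟩).2
  · intro v w hv hw h
    simp only [hv, hw, dite_false] at h
    have := f.injective (Subtype.ext h)
    simpa using this
  · rintro ⟨a, ha⟩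
    apply Subtype.ext
    funext v
    by_cases hv : v ∈ V
    · simp [hv, ha.1 v hv]
    · simp only [hv, dite_false]; rfl
  · intro f
    ext v
    simp [v.2]

theorem card_GConfig {n : ℕ} (hn : 0 < n) (k : ℕ) (hk : 1 ≤ k) :
    Nat.card {c : GConfig n // c.root = ⟨0, hn⟩ ∧ c.V.card = k} =
      (n - 1).choose (k - 1) * (tt k * (n - 1).descFactorial (n - k)) := by
  classical
  let r : Fin n := ⟨0, hn⟩
  have e : {c : GConfig n // c.root = r ∧ c.V.card = k} ≃
      (Σ V : {V : Finset (Fin n) // r ∈ V ∧ V.card = k},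
        {G // TreeOn V.1 G} × {a // ArcOn V.1 r a}) :=
    { toFun := fun c => ⟨⟨c.1.V, (by have := c.1.hroot; rwa [c.2.1] at this), c.2.2⟩,
        ⟨c.1.tree, c.1.hedge, c.1.hconn, c.1.hacyc⟩,
        ⟨c.1.arc, c.1.harcV, (by have := c.1.harc; rwa [c.2.1] at this), c.1.hinj⟩⟩
      invFun := fun x => ⟨⟨x.1.1, r, x.1.2.1, x.2.1.1, x.2.1.2.1, x.2.1.2.2.1, x.2.1.2.2.2,
        x.2.2.1, x.2.2.2.1, x.2.2.2.2.1, x.2.2.2.2.2⟩, rfl, x.1.2.2⟩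
      left_inv := by
        rintro ⟨⟨V, root, h1, h2, h3, h4, h5, h6, h7, h8, h9⟩, h10, h11⟩
        simp only at h10
        subst h10
        rfl
      right_inv := by
        intro x
        rfl }
  rw [Nat.card_congr e, Nat.card_sigma]
  have h : ∀ V : {V : Finset (Fin n) // r ∈ V ∧ V.card = k},
      Nat.card ({G // TreeOn V.1 G} × {a // ArcOn V.1 r a}) =
        tt k * (n - 1).descFactorial (n - k) := by
    intro V
    rw [Nat.card_prod, card_TreeOn _ ⟨r, V.2.1⟩, card_ArcOn, V.2.2]
  simp only [h, Finset.sum_const, smul_eq_mul, Finset.card_univ]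
  congr 1
  have : (n - 1).choose (k - 1) =
      (Finset.powersetCard (k - 1) ((Finset.univ : Finset (Fin n)).erase r)).card := by
    simp
  rw [this, Fintype.card_subtype]
  refine Finset.card_bij' (fun V _ => V.erase r) (fun V _ => insert r V) ?_ ?_ ?_ ?_
  · intro V hV
    simp only [Finset.mem_filter, Finset.mem_univ, true_and] at hV
    rw [Finset.mem_powersetCard, Finset.card_erase_of_mem hV.1, hV.2]
    exact ⟨Finset.erase_subset_erase _ (Finset.subset_univ _), rfl⟩
  · intro V hV
    rw [Finset.mem_powersetCard] at hV
    have : r ∉ V := fun h => by simpa using hV.1 h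
    simp only [Finset.mem_filter, Finset.mem_univ, true_and]
    rw [Finset.card_insert_of_notMem this, hV.2]
    exact ⟨Finset.mem_insert_self _ _, by omega⟩
  · intro V hV
    simp only [Finset.mem_filter, Finset.mem_univ, true_and] at hV
    exact Finset.insert_erase hV.1
  · intro V hV
    rw [Finset.mem_powersetCard] at hV
    exact Finset.erase_insert (fun h => by simpa using hV.1 h)

theorem num_identity (N m : ℕ) (hm : m < N) :
    N.choose (m + 1) * N.descFactorial (m + 1) = N.choose (m + 1) * (N - 1).descFactorial (m + 1) +
      N.choose m * ((N - 1).descFactorial m * (N - m)) := by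
  obtain ⟨M, rfl⟩ : ∃ M, N = M + 1 := ⟨N - 1, by omega⟩
  obtain ⟨j, rfl⟩ : ∃ j, M = m + j := ⟨M - m, by omega⟩
  rw [Nat.succ_descFactorial_succ, Nat.add_sub_cancel, Nat.descFactorial_succ]
  have h := Nat.choose_succ_right_eq (m + j + 1) m
  have h1 : m + j - m = j := by omega
  rw [h1]
  linear_combination ((m + j).descFactorial m) * h

theorem card_lca_formula (N : ℕ) :
    (∑ S : Finset (Fin (N + 1)), (-1) ^ S.card * (NT (Fin (N + 1)) 0 S : ℤ)) =
      ∑ m ∈ Finset.range (N + 1), (-1 : ℤ) ^ m *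
        (N.choose m * (tt (N + 1 - m) * N.descFactorial m)) := by
  classical
  have hu : (Finset.univ : Finset (Finset (Fin (N + 1)))) =
      (insert 0 ((Finset.univ : Finset (Fin (N + 1))).erase 0)).powerset := by
    rw [Finset.insert_erase (Finset.mem_univ _)]; simp
  rw [hu, Finset.sum_powerset_insert (by simp)]
  have hA : ∀ S ∈ ((Finset.univ : Finset (Fin (N + 1))).erase 0).powerset,
      (-1) ^ S.card * (NT (Fin (N + 1)) 0 S : ℤ) =
        (fun m => (-1 : ℤ) ^ m * (((N - 1).descFactorial m * tt (N + 1 - m) : ℕ) : ℤ)) S.card := by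
    intro S hS
    have h0 : (0 : Fin (N + 1)) ∉ S := fun h => by simpa using Finset.mem_powerset.1 hS h
    have := (NT_formula S.card (0 : Fin (N + 1)) (S : Set _) (by simpa using h0) (by simp)).1
    rw [this]
    simp only [Fintype.card_fin]
    rfl
  have hB : ∀ S ∈ ((Finset.univ : Finset (Fin (N + 1))).erase 0).powerset,
      (-1) ^ (insert 0 S).card * (NT (Fin (N + 1)) 0 ((insert 0 S : Finset _) : Set _) : ℤ) =
        (fun m => (-1 : ℤ) ^ (m + 1) *
          (((N - 1).descFactorial m * ((N - m) * tt (N - m)) : ℕ) : ℤ)) S.card := by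
    intro S hS
    have h0 : (0 : Fin (N + 1)) ∉ S := fun h => by simpa using Finset.mem_powerset.1 hS h
    have := (NT_formula S.card (0 : Fin (N + 1)) (S : Set _) (by simpa using h0) (by simp)).2
    rw [Finset.coe_insert, this, Finset.card_insert_of_notMem h0]
    simp only [Fintype.card_fin]
    rfl
  rw [Finset.sum_congr rfl hA, Finset.sum_congr rfl hB,
    Finset.sum_powerset_apply_card
      (fun m => (-1 : ℤ) ^ m * (((N - 1).descFactorial m * tt (N + 1 - m) : ℕ) : ℤ)),
    Finset.sum_powerset_apply_card (fun m => (-1 : ℤ) ^ (m + 1) *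
          (((N - 1).descFactorial m * ((N - m) * tt (N - m)) : ℕ) : ℤ))]
  have hc : ((Finset.univ : Finset (Fin (N + 1))).erase 0).card = N := by simp
  rw [hc, Finset.sum_range_succ' _ N, Finset.sum_range_succ _ N, Finset.sum_range_succ' _ N]
  simp only [Nat.sub_self, zero_mul, mul_zero, Nat.cast_zero, smul_zero, add_zero]
  rw [add_right_comm, ← Finset.sum_add_distrib]
  congr 1
  · refine Finset.sum_congr rfl fun m hm => ?_
    have h := num_identity N m (Finset.mem_range.1 hm)
    have h1 : N + 1 - (m + 1) = N - m := by omega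
    rw [h1]
    zify at h
    simp only [nsmul_eq_mul]
    push_cast
    linear_combination (-(-1 : ℤ) ^ (m + 1) * (tt (N - m) : ℤ)) * h
  · simp

theorem stmt12 (n : ℕ) (hn : 0 < n) :
    (∑ k ∈ Finset.Icc 1 n, (-1 : ℤ) ^ (n - k) *
        Nat.card {c : GConfig n // c.root = ⟨0, hn⟩ ∧ c.V.card = k}) =
      Nat.card {G : SimpleGraph (Fin n) // G.IsTree ∧
        ∀ v, (children G ⟨0, hn⟩ v).ncard ≠ 1} := by
  rw [card_lca]
  obtain ⟨N, rfl⟩ : ∃ N, n = N + 1 := ⟨n - 1, by omega⟩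
  have h0 : (⟨0, hn⟩ : Fin (N + 1)) = 0 := rfl
  rw [h0, card_lca_formula]
  refine Finset.sum_bij' (fun k _ => N + 1 - k) (fun m _ => N + 1 - m) ?_ ?_ ?_ ?_ ?_
  · intro k hk; simp only [Finset.mem_Icc, Finset.mem_range] at *; omega
  · intro k hk; simp only [Finset.mem_Icc, Finset.mem_range] at *; omega
  · intro k hk; simp only [Finset.mem_Icc] at *; omega
  · intro k hk; simp only [Finset.mem_range] at *; omega
  · intro k hk
    simp only [Finset.mem_Icc] at hk
    have := card_GConfig hn k hk.1
    rw [h0] at this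
    rw [this]
    have h1 : N + 1 - (N + 1 - k) = k := by omega
    have h2 : N.choose (k - 1) = N.choose (N + 1 - k) := by
      rw [← Nat.choose_symm (by omega : k - 1 ≤ N)]
      congr 1; omega
    rw [h1, Nat.add_sub_cancel, h2]
    push_cast
    rfl
end
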